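/- arXiv:2106.11590 — 2 statements merged into one kernel-verified Lean document; each statement's English description precedes it below -/
import Mathlib

section
/- Let d be a positive odd squarefree integer, n ≥ 1, and p an odd prime with p ∤ d. Let R = ℤ[√-d]/(p) with σ the ring endomorphism induced by conjugation, and let L = diag(1,…,1,-1) of size n+1. Then the number of matrices A ∈ M_{n+1}(R) with A·L·σ(A)ᵀ = L and det A = 1 equals p^{n(n+1)/2} · ∏_{i=2}^{n+1} (p^i - χ^i), where χ = (-d/p) is the Legendre symbol. -/
open Matrix

/-- The quotient ring `ℤ[√-d]/(m)`. -/
abbrev Rq (d m : ℤ) : Type := Zsqrtd (-d) ⧸ Ideal.span {(m : Zsqrtd (-d))}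

/-- Conjugation `a + b√-d ↦ a - b√-d` descends to the quotient `ℤ[√-d]/(m)`. -/
noncomputable def conjQ (d m : ℤ) : Rq d m →+* Rq d m :=
  Ideal.quotientMap (Ideal.span {(m : Zsqrtd (-d))}) (starRingEnd (Zsqrtd (-d)))
    (by
      rw [Ideal.span_singleton_le_iff_mem, Ideal.mem_comap, map_intCast]
      exact Ideal.mem_span_singleton_self _)

/-- The diagonal matrix `diag(1, …, 1, -1)` of size `n+1`. -/
def Lmat (R : Type*) [Ring R] (n : ℕ) : Matrix (Fin (n + 1)) (Fin (n + 1)) R :=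
  Matrix.diagonal fun i => if i = Fin.last n then -1 else 1

theorem prod_range_mul_pow_sub (q ε : ℤ) (n : ℕ) :
    ∏ i ∈ Finset.range (n + 1), q ^ i * (q ^ (i + 1) - ε ^ (i + 1)) =
      (q - ε) * (q ^ (n * (n + 1) / 2) * ∏ i ∈ Finset.Icc 2 (n + 1), (q ^ i - ε ^ i)) := by
  induction n with
  | zero => simp
  | succ n ih =>
    have h : (n + 1) * (n + 1 + 1) / 2 = n * (n + 1) / 2 + (n + 1) := by
      simpa [mul_comm] using Nat.triangle_succ (n + 1)
    rw [Finset.prod_range_succ, ih, Finset.prod_Icc_succ_top (show 2 ≤ n + 1 + 1 by omega), h,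
      pow_add]
    ring

section SpecialLinear

variable {F : Type*} [Field F]

theorem card_det_eq_one_mul [Finite F] (n : ℕ) :
    ((Nat.card F : ℤ) - 1) * Nat.card {B : Matrix (Fin (n + 1)) (Fin (n + 1)) F // B.det = 1} =
      ∏ i ∈ Finset.range (n + 1), (Nat.card F : ℤ) ^ i * ((Nat.card F : ℤ) ^ (i + 1) - 1) := by
  classical
  have := Fintype.ofFinite F
  let φ : GL (Fin (n + 1)) F →* Fˣ := GeneralLinearGroup.det
  have hφ : Function.Surjective φ := fun u =>
    ⟨GeneralLinearGroup.mkOfDetNeZero (diagonal (Function.update 1 0 (u : F)))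
      (by simp [det_diagonal, Finset.prod_update_of_mem]), by
      ext
      simp [φ, GeneralLinearGroup.mkOfDetNeZero, det_diagonal, Finset.prod_update_of_mem]⟩
  have hker : Nat.card φ.ker =
      Nat.card {B : Matrix (Fin (n + 1)) (Fin (n + 1)) F // B.det = 1} :=
    Nat.card_congr
      { toFun := fun B => ⟨B.1, by simpa [φ] using congrArg Units.val B.2⟩
        invFun := fun B => ⟨GeneralLinearGroup.mkOfDetNeZero B.1 (by simp [B.2]), by
          rw [MonoidHom.mem_ker]
          ext
          simp [φ, GeneralLinearGroup.mkOfDetNeZero, B.2]⟩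
        left_inv := fun B => by ext; rfl
        right_inv := fun B => rfl }
  have h1 := Subgroup.card_mul_index φ.ker
  rw [Subgroup.index_ker, MonoidHom.range_eq_top.2 hφ, hker, Subgroup.card_top, Nat.card_units,
    Matrix.card_GL_field, ← Nat.card_eq_fintype_card] at h1
  have hpos : 1 ≤ Nat.card F := Nat.card_pos
  have h2 := congrArg (Nat.cast : ℕ → ℤ) h1
  rw [Nat.cast_mul, Nat.cast_sub hpos, Nat.cast_one, mul_comm] at h2
  rw [h2, Nat.cast_prod, Finset.prod_mul_distrib]
  rw [← Finset.prod_range_reflect (fun i => (Nat.card F : ℤ) ^ (i + 1) - 1),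
    ← Finset.prod_mul_distrib, ← Fin.prod_univ_eq_prod_range]
  refine Finset.prod_congr rfl fun i _ => ?_
  have hi := i.2
  rw [Nat.cast_sub (Nat.pow_le_pow_right hpos hi.le), mul_sub, ← pow_add]
  push_cast
  rw [mul_one]
  congr 2
  omega

theorem Lmat_mul_self (R : Type*) [Ring R] (n : ℕ) : Lmat R n * Lmat R n = 1 := by
  rw [Lmat, diagonal_mul_diagonal, ← diagonal_one]
  congr 1
  ext i
  split_ifs <;> simp

theorem Lmat_transpose (R : Type*) [Ring R] (n : ℕ) : (Lmat R n)ᵀ = Lmat R n := by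
  simp [Lmat]

theorem Lmat_map {R S : Type*} [Ring R] [Ring S] (φ : R →+* S) (n : ℕ) :
    (Lmat R n).map φ = Lmat S n := by
  rw [Lmat, Lmat, diagonal_map (map_zero φ)]
  congr 1
  ext i
  split_ifs <;> simp

theorem card_SU_split {R : Type*} [CommRing R] (σ : R →+* R) (φ ψ : R →+* F)
    (hφ : ∀ x, φ (σ x) = ψ x) (hψ : ∀ x, ψ (σ x) = φ x)
    (hinj : ∀ x y, φ x = φ y → ψ x = ψ y → x = y) (hsurj : ∀ a b, ∃ x, φ x = a ∧ ψ x = b) (n : ℕ) :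
    Nat.card {A : Matrix (Fin (n + 1)) (Fin (n + 1)) R //
        A * Lmat R n * (A.map σ)ᵀ = Lmat R n ∧ A.det = 1} =
      Nat.card {B : Matrix (Fin (n + 1)) (Fin (n + 1)) F // B.det = 1} := by
  have hext : ∀ A A' : Matrix (Fin (n + 1)) (Fin (n + 1)) R,
      A.map φ = A'.map φ → A.map ψ = A'.map ψ → A = A' := fun A A' h h' => by
    ext i j
    exact hinj _ _ (congrFun (congrFun h i) j) (congrFun (congrFun h' i) j)
  have hσφ : ∀ A : Matrix (Fin (n + 1)) (Fin (n + 1)) R, (A.map σ).map φ = A.map ψ :=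
    fun A => by ext; simp [hφ]
  have hσψ : ∀ A : Matrix (Fin (n + 1)) (Fin (n + 1)) R, (A.map σ).map ψ = A.map φ :=
    fun A => by ext; simp [hψ]
  have hdet : ∀ (f : R →+* F) (A : Matrix (Fin (n + 1)) (Fin (n + 1)) R),
      (A.map f).det = f A.det := fun f A => (RingHom.map_det f A).symm
  have hcond : ∀ A : Matrix (Fin (n + 1)) (Fin (n + 1)) R,
      A * Lmat R n * (A.map σ)ᵀ = Lmat R n →
      A.map φ * Lmat F n * (A.map ψ)ᵀ = Lmat F n := fun A hA => by
    have := congrArg (fun M => M.map φ) hA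
    simpa only [Matrix.map_mul, transpose_map, hσφ, Lmat_map] using this
  refine Nat.card_congr (Equiv.ofBijective
    (fun A => ⟨A.1.map φ, by rw [hdet, A.2.2, map_one]⟩) ⟨?_, ?_⟩)
  · rintro ⟨A, hA, hA1⟩ ⟨A', hA', hA1'⟩ h
    have h : A.map φ = A'.map φ := congrArg Subtype.val h
    refine Subtype.ext (hext A A' h ?_)
    have h1 := hcond A hA
    have h2 := hcond A' hA'
    rw [← h] at h2
    have hu : IsUnit (A.map φ * Lmat F n) := by
      refine IsUnit.mul ?_ (IsUnit.of_mul_eq_one _ (Lmat_mul_self F n))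
      rw [Matrix.isUnit_iff_isUnit_det, hdet, hA1, map_one]
      exact isUnit_one
    exact transpose_injective (hu.mul_left_cancel (h1.trans h2.symm))
  · rintro ⟨B, hB⟩
    have hBu : IsUnit B.det := by rw [hB]; exact isUnit_one
    set C : Matrix (Fin (n + 1)) (Fin (n + 1)) F := (Lmat F n * B⁻¹ * Lmat F n)ᵀ with hC
    have hBC : B * Lmat F n * Cᵀ = Lmat F n := by
      rw [hC, transpose_transpose]
      simp only [← Matrix.mul_assoc]
      rw [Matrix.mul_assoc B, Lmat_mul_self, Matrix.mul_one, Matrix.mul_nonsing_inv _ hBu,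
        Matrix.one_mul]
    have hCB : C * Lmat F n * Bᵀ = Lmat F n := by
      have := congrArg transpose hBC
      simpa only [transpose_mul, transpose_transpose, Lmat_transpose, ← Matrix.mul_assoc] using this
    have hC1 : C.det = 1 := by
      have h1 := congrArg det (Lmat_mul_self F n)
      rw [det_mul, det_one] at h1
      rw [hC, det_transpose, det_mul, det_mul, mul_right_comm, h1, one_mul, det_nonsing_inv, hB]
      simp
    choose f hf1 hf2 using hsurj
    let A : Matrix (Fin (n + 1)) (Fin (n + 1)) R := of fun i j => f (B i j) (C i j)
    have hA1 : A.map φ = B := by ext; simp [A, hf1]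
    have hA2 : A.map ψ = C := by ext; simp [A, hf2]
    refine ⟨⟨A, ?_, ?_⟩, Subtype.ext hA1⟩
    · apply hext
      · simpa only [Matrix.map_mul, transpose_map, hσφ, Lmat_map, hA1, hA2] using hBC
      · simpa only [Matrix.map_mul, transpose_map, hσψ, Lmat_map, hA1, hA2] using hCB
    · apply hinj
      · rw [← hdet, hA1, hB, map_one]
      · rw [← hdet, hA2, hC1, map_one]

end SpecialLinear

theorem Nat.card_eq_mul_of_card_fiber {α β : Type*} [Finite α] [Finite β] (f : α → β) (k : ℕ)
    (h : ∀ b, Nat.card {a // f a = b} = k) : Nat.card α = Nat.card β * k := by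
  have := Fintype.ofFinite β
  rw [← Nat.card_congr (Equiv.sigmaFiberEquiv f), Nat.card_sigma]
  simp [h]

/-- A finite field of order `q ^ 2` has `q + 1` elements of each nonzero norm. -/
theorem FiniteField.card_mul_pow_eq {K : Type*} [Field K] [Finite K] {q : ℕ}
    (hq : Nat.card K = q ^ 2) {t : K}
    (ht0 : t ≠ 0) (ht : t ^ q = t) : Nat.card {x : K // x * x ^ q = t} = q + 1 := by
  classical
  have := Fintype.ofFinite K
  have hq1 : 1 < q := by
    have : 1 < Nat.card K := Finite.one_lt_card
    rw [hq] at this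
    by_contra h
    interval_cases q <;> simp at this
  have hcard : Nat.card Kˣ = (q + 1) * (q - 1) := by
    rw [Nat.card_units, hq]
    obtain ⟨r, rfl⟩ : ∃ r, q = r + 1 := ⟨q - 1, by omega⟩
    simp; ring_nf; omega
  let φ : Kˣ →* Kˣ := powMonoidHom (q + 1)
  have hker : Nat.card φ.ker = q + 1 := by
    rw [IsCyclic.card_powMonoidHom_ker, hcard]; simp
  obtain ⟨u, rfl⟩ : ∃ u : Kˣ, (u : K) = t := ⟨Units.mk0 t ht0, rfl⟩
  have hu : u ∈ φ.range := by
    have h1 : u ^ (q - 1) = 1 := by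
      have h2 : u ^ q = u := by ext; simpa using ht
      have h3 : u ^ (q - 1) * u = 1 * u := by
        rw [← pow_succ, Nat.sub_add_cancel hq1.le, h2, one_mul]
      exact mul_right_cancel h3
    obtain ⟨g, hg⟩ := IsCyclic.exists_generator (α := Kˣ)
    obtain ⟨k, rfl⟩ := (Subgroup.mem_zpowers_iff.1 (hg u))
    have h4 : (orderOf g : ℤ) ∣ k * (q - 1 : ℕ) := by
      rw [orderOf_dvd_iff_zpow_eq_one, _root_.zpow_mul, zpow_natCast, h1]
    rw [orderOf_eq_card_of_forall_mem_zpowers hg, hcard, Nat.cast_mul] at h4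
    have h5 := Int.dvd_of_mul_dvd_mul_right (by omega) h4
    obtain ⟨j, rfl⟩ := h5
    exact ⟨g ^ j, by simp [φ, ← zpow_natCast, ← _root_.zpow_mul, mul_comm, -Nat.cast_add]⟩
  obtain ⟨v, hv⟩ := hu
  rw [← hker]
  symm
  refine Nat.card_congr (Equiv.ofBijective
    (fun w : φ.ker => (⟨((v * w : Kˣ) : K), ?_⟩ : {x : K // x * x ^ q = u})) ⟨?_, ?_⟩)
  · have hw : (w : Kˣ) ^ (q + 1) = 1 := w.2
    have hv' : v ^ (q + 1) = u := hv
    rw [← pow_succ', ← Units.val_pow_eq_pow_val, mul_pow, hw, hv', mul_one]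
  · intro w w' h
    exact Subtype.ext (Units.ext (by simpa using h))
  · rintro ⟨x, hx⟩
    have hx0 : x ≠ 0 := by rintro rfl; simp at hx; exact u.ne_zero hx.symm
    refine ⟨⟨v⁻¹ * Units.mk0 x hx0, ?_⟩, by simp⟩
    have hv' : v ^ (q + 1) = u := hv
    have : (Units.mk0 x hx0) ^ (q + 1) = u := by ext; simp [pow_succ', hx]
    rw [MonoidHom.mem_ker]
    simp [φ, mul_pow, this, hv']

section Hermitian

variable {K : Type*} [Field K] [StarRing K]

theorem card_dotProduct_star_eq [Finite K] {q : ℕ} (hq : Nat.card K = q ^ 2)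
    (hstar : ∀ x : K, star x = x ^ q) (N : ℕ) (t : K) (ht : star t = t) [DecidableEq K] :
    (q : ℤ) * Nat.card {v : Fin N → K // v ⬝ᵥ star v = t} =
      q ^ (2 * N) - (-q) ^ N + if t = 0 then (q : ℤ) * (-q) ^ N else 0 := by
  have := Fintype.ofFinite K
  induction N generalizing t with
  | zero =>
    by_cases h : t = 0
    · subst h
      simp
    · have : IsEmpty {v : Fin 0 → K // v ⬝ᵥ star v = t} := ⟨fun v => h (by simpa using v.2.symm)⟩
      rw [Nat.card_of_isEmpty]
      simp [h]
  | succ N ih =>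
    have e : {v : Fin (N + 1) → K // v ⬝ᵥ star v = t} ≃
        Σ x : K, {v : Fin N → K // v ⬝ᵥ star v = t - x * star x} :=
      { toFun := fun v => ⟨v.1 0, fun i => v.1 i.succ, by
          have := v.2
          simp only [dotProduct, Fin.sum_univ_succ, Pi.star_apply] at this
          simp [dotProduct, ← this]⟩
        invFun := fun v => ⟨Fin.cons v.1 v.2.1, by
          have := v.2.2
          simp only [dotProduct, Pi.star_apply] at this
          simp [dotProduct, Fin.sum_univ_succ, this]⟩
        left_inv := fun v => by ext i; refine Fin.cases ?_ (fun i => ?_) i <;> simp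
        right_inv := fun v => rfl }
    have hs : ∀ x : K, star (t - x * star x) = t - x * star x := fun x => by
      simp [ht, mul_comm]
    have hc : (Nat.card {x : K // t - x * star x = 0} : ℤ) = 1 + q - if t = 0 then (q : ℤ) else 0 := by
      have h1 : Nat.card {x : K // t - x * star x = 0} = Nat.card {x : K // x * x ^ q = t} :=
        Nat.card_congr (Equiv.subtypeEquivRight fun x => by rw [hstar, sub_eq_zero, eq_comm])
      rw [h1]
      by_cases h : t = 0
      · subst h
        have hq0 : q ≠ 0 := by
          rintro rfl
          simp at hq
        have : ∀ x : K, x * x ^ q = 0 ↔ x = 0 := fun x => by simp [hq0]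
        simp [this]
      · rw [FiniteField.card_mul_pow_eq hq h (by rw [← hstar, ht])]
        simp [h, add_comm]
    rw [Nat.card_congr e, Nat.card_sigma, Nat.cast_sum, Finset.mul_sum,
      Finset.sum_congr rfl fun x _ => ih _ (hs x), Finset.sum_add_distrib, ← Finset.sum_filter,
      Finset.sum_const, Finset.sum_const, nsmul_eq_mul, nsmul_eq_mul, ← Fintype.card_subtype,
      ← Nat.card_eq_fintype_card, hc, Finset.card_univ, ← Nat.card_eq_fintype_card, hq]
    push_cast
    split_ifs <;> ring

variable {m : Type*} [Fintype m] [DecidableEq m]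

theorem exists_unitary_mulVec_eq_of_ne (u v : m → K) (hu : u ⬝ᵥ star u = 1)
    (hv : v ⬝ᵥ star v = 1) (h : u ⬝ᵥ star v ≠ 1) :
    ∃ A : Matrix m m K, A * Aᴴ = 1 ∧ A *ᵥ u = v := by
  set b := u ⬝ᵥ star v with hb
  have hb' : v ⬝ᵥ star u = star b := by
    simp [hb, dotProduct, mul_comm]
  have ha : 1 - b ≠ 0 := sub_ne_zero.2 (Ne.symm h)
  have ha' : 1 - star b ≠ 0 := by
    simpa using star_ne_zero.2 ha
  set w := u - v with hw
  have hww : star w ⬝ᵥ w = (1 - b) + (1 - star b) := by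
    rw [dotProduct_comm, hw, star_sub, sub_dotProduct, dotProduct_sub, dotProduct_sub, hu, hv,
      ← hb, hb']
    ring
  have hwu : star w ⬝ᵥ u = 1 - b := by
    rw [dotProduct_comm, hw, star_sub, dotProduct_sub, hu, ← hb]
  refine ⟨1 - (1 - b)⁻¹ • vecMulVec w (star w), ?_, ?_⟩
  · have h1 : (vecMulVec w (star w))ᴴ = vecMulVec w (star w) := by
      rw [conjTranspose_vecMulVec, star_star]
    have h2 : vecMulVec w (star w) * vecMulVec w (star w) =
        ((1 - b) + (1 - star b)) • vecMulVec w (star w) := by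
      rw [vecMulVec_mul_vecMulVec, hww, vecMulVec_smul]
    rw [conjTranspose_sub, conjTranspose_one, conjTranspose_smul, h1, sub_mul, mul_sub, mul_sub,
      one_mul, mul_one, one_mul, smul_mul_smul_comm, h2, smul_smul, star_inv₀, star_sub, star_one]
    rw [sub_sub, sub_eq_self, ← add_sub_assoc, ← add_smul, ← sub_smul]
    convert zero_smul K _
    field_simp
    ring
  · rw [sub_mulVec, one_mulVec, smul_mulVec, vecMulVec_mulVec, hwu]
    ext i
    simp [hw, ha, mul_comm]

/-- The unitary group of a Hermitian space acts transitively on vectors of norm one. -/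
theorem exists_unitary_mulVec_eq (h2 : (2 : K) ≠ 0) (u v : m → K) (hu : u ⬝ᵥ star u = 1)
    (hv : v ⬝ᵥ star v = 1) : ∃ A : Matrix m m K, A * Aᴴ = 1 ∧ A *ᵥ u = v := by
  by_cases h : u ⬝ᵥ star v = 1
  · obtain ⟨A, hA, hAu⟩ := exists_unitary_mulVec_eq_of_ne u (-v) hu (by simpa using hv) (by
      rw [star_neg, dotProduct_neg, h]
      intro h3
      exact h2 (by linear_combination -h3))
    exact ⟨-A, by simpa using hA, by rw [neg_mulVec, hAu, neg_neg]⟩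
  · exact exists_unitary_mulVec_eq_of_ne u v hu hv h

theorem card_unitary_reindex {m' : Type*} [Fintype m'] [DecidableEq m'] (e : m ≃ m') :
    Nat.card {A : Matrix m m K // A * Aᴴ = 1} = Nat.card {A : Matrix m' m' K // A * Aᴴ = 1} :=
  Nat.card_congr <| (Matrix.reindex e e).subtypeEquiv fun A => by
    rw [← (Matrix.reindex e e).injective.eq_iff]
    simp [Matrix.submatrix_mul_equiv, conjTranspose_submatrix]

/-- Unitary matrices fixing the first basis vector are unitary matrices of one size less. -/
def unitaryStabilizerEquiv :
    {A : {A : Matrix (Unit ⊕ m) (Unit ⊕ m) K // A * Aᴴ = 1} //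
      A.1 *ᵥ Pi.single (Sum.inl ()) 1 = Pi.single (Sum.inl ()) 1} ≃
    {B : Matrix m m K // B * Bᴴ = 1} where
  toFun A := ⟨A.1.1.toBlocks₂₂, by
    obtain ⟨⟨A, hA⟩, h⟩ := A
    obtain ⟨a, b, c, d, rfl⟩ : ∃ a b c d, A = fromBlocks a b c d :=
      ⟨_, _, _, _, (fromBlocks_toBlocks A).symm⟩
    have hc : c = 0 := by
      ext i j
      simpa using congrFun h (Sum.inr i)
    subst hc
    rw [fromBlocks_conjTranspose, fromBlocks_multiply, ← fromBlocks_one, fromBlocks_inj] at hA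
    simpa using hA.2.2.2⟩
  invFun B := ⟨⟨fromBlocks 1 0 0 B.1, by
    rw [fromBlocks_conjTranspose, fromBlocks_multiply, ← fromBlocks_one, fromBlocks_inj]
    simp [B.2]⟩, by
    ext i
    rcases i with i | i <;> simp⟩
  left_inv A := by
    obtain ⟨⟨A, hA⟩, h⟩ := A
    obtain ⟨a, b, c, d, rfl⟩ : ∃ a b c d, A = fromBlocks a b c d :=
      ⟨_, _, _, _, (fromBlocks_toBlocks A).symm⟩
    have hc : c = 0 := by
      ext i j
      simpa using congrFun h (Sum.inr i)
    have ha : a = 1 := by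
      ext i j
      simpa using congrFun h (Sum.inl i)
    subst hc ha
    have hb : b = 0 := by
      rw [mul_eq_one_comm, fromBlocks_conjTranspose, fromBlocks_multiply, ← fromBlocks_one,
        fromBlocks_inj] at hA
      simpa using hA.2.1
    subst hb
    rfl
  right_inv B := rfl

theorem card_unitary_succ [Finite K] (h2 : (2 : K) ≠ 0) :
    Nat.card {A : Matrix (Unit ⊕ m) (Unit ⊕ m) K // A * Aᴴ = 1} =
      Nat.card {v : Unit ⊕ m → K // v ⬝ᵥ star v = 1} *
        Nat.card {A : Matrix m m K // A * Aᴴ = 1} := by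
  set e : Unit ⊕ m → K := Pi.single (Sum.inl ()) 1
  have he : e ⬝ᵥ star e = 1 := by simp [e]
  have hmaps (A : {A : Matrix (Unit ⊕ m) (Unit ⊕ m) K // A * Aᴴ = 1}) :
      (A.1 *ᵥ e) ⬝ᵥ star (A.1 *ᵥ e) = 1 := by
    have := mul_eq_one_comm.1 A.2
    rw [star_mulVec, dotProduct_comm, ← dotProduct_mulVec, mulVec_mulVec, this, one_mulVec,
      dotProduct_comm, he]
  refine Nat.card_eq_mul_of_card_fiber
    (fun A => (⟨A.1 *ᵥ e, hmaps A⟩ : {v : Unit ⊕ m → K // v ⬝ᵥ star v = 1})) _ fun v => ?_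
  · obtain ⟨g, hg, hgv⟩ := exists_unitary_mulVec_eq h2 e v.1 he v.2
    have hg' := mul_eq_one_comm.1 hg
    rw [← Nat.card_congr unitaryStabilizerEquiv]
    symm
    refine Nat.card_congr
      { toFun := fun A => ⟨⟨g * A.1.1, ?_⟩, ?_⟩
        invFun := fun A => ⟨⟨gᴴ * A.1.1, ?_⟩, ?_⟩
        left_inv := fun A => ?_
        right_inv := fun A => ?_ }
    · rw [conjTranspose_mul, mul_assoc, ← mul_assoc A.1.1, A.1.2, one_mul, hg]
    · ext1
      have hA : A.1.1 *ᵥ e = e := A.2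
      change (g * A.1.1) *ᵥ e = v.1
      rw [← hgv, ← mulVec_mulVec, hA]
    · rw [conjTranspose_mul, mul_assoc, ← mul_assoc A.1.1, A.1.2, one_mul,
        conjTranspose_conjTranspose, hg']
    · have this : A.1.1 *ᵥ e = v.1 := congrArg Subtype.val A.2
      change (gᴴ * A.1.1) *ᵥ e = e
      rw [← mulVec_mulVec, this, ← hgv, mulVec_mulVec, hg', one_mulVec]
    · ext1; ext1
      simp [← mul_assoc, hg']
    · ext1; ext1
      simp [← mul_assoc, hg]

theorem card_unitary_eq_card_special_unitary_mul [Finite K] [Nonempty m] :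
    Nat.card {A : Matrix m m K // A * Aᴴ = 1} =
      Nat.card {x : K // x * star x = 1} *
        Nat.card {A : Matrix m m K // A * Aᴴ = 1 ∧ A.det = 1} := by
  have hmaps (A : {A : Matrix m m K // A * Aᴴ = 1}) : A.1.det * star A.1.det = 1 := by
    rw [← det_conjTranspose, ← det_mul, A.2, det_one]
  refine Nat.card_eq_mul_of_card_fiber
    (fun A => (⟨A.1.det, hmaps A⟩ : {x : K // x * star x = 1})) _ fun c => ?_
  · obtain ⟨i⟩ := ‹Nonempty m›
    let g : Matrix m m K := diagonal (Function.update 1 i c.1)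
    have hg : g * gᴴ = 1 := by
      simp only [g, diagonal_conjTranspose, diagonal_mul_diagonal, ← diagonal_one]
      congr 1
      ext j
      by_cases h : j = i
      · subst h; simp [c.2]
      · simp [h]
    have hd : g.det = c := by simp [g, det_diagonal, Finset.prod_update_of_mem]
    have hg' := mul_eq_one_comm.1 hg
    symm
    refine Nat.card_congr
      { toFun := fun A => ⟨⟨g * A.1, ?_⟩, ?_⟩
        invFun := fun A => ⟨gᴴ * A.1.1, ?_, ?_⟩
        left_inv := fun A => ?_
        right_inv := fun A => ?_ }
    · rw [conjTranspose_mul, mul_assoc, ← mul_assoc A.1, A.2.1, one_mul, hg]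
    · ext1
      simp [hd, A.2.2]
    · rw [conjTranspose_mul, mul_assoc, ← mul_assoc A.1.1, A.1.2, one_mul,
        conjTranspose_conjTranspose, hg']
    · have := congrArg Subtype.val A.2
      dsimp only at this
      rw [det_mul, det_conjTranspose, this, hd, mul_comm, c.2]
    · ext1
      simp [← mul_assoc, hg']
    · ext1; ext1
      simp [← mul_assoc, hg]

end Hermitian

section Rq

variable (d : ℤ) (p : ℕ)

theorem Rq.mk_eq_zero_iff (z : ℤ√(-d)) :
    (Ideal.Quotient.mk _ z : Rq d p) = 0 ↔ (p : ℤ) ∣ z.re ∧ (p : ℤ) ∣ z.im := by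
  rw [Ideal.Quotient.eq_zero_iff_mem, Ideal.mem_span_singleton, Zsqrtd.intCast_dvd]

instance Rq.charP : CharP (Rq d p) p where
  cast_eq_zero_iff n := by
    have := Rq.mk_eq_zero_iff d p (n : ℤ√(-d))
    rw [map_natCast] at this
    simpa [Int.natCast_dvd_natCast] using this

/-- The image of `√-d` in `ℤ[√-d]/(p)`. -/
noncomputable def Rq.sqrt : Rq d p := Ideal.Quotient.mk _ Zsqrtd.sqrtd

theorem Rq.sqrt_mul_sqrt : Rq.sqrt d p * Rq.sqrt d p = ((-d : ℤ) : Rq d p) := by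
  rw [Rq.sqrt, ← map_mul, Zsqrtd.dmuld, map_intCast]

theorem Rq.conjQ_sqrt : conjQ d p (Rq.sqrt d p) = -Rq.sqrt d p := by
  rw [Rq.sqrt, conjQ, Ideal.quotientMap_mk, ← map_neg]
  congr 1

theorem Rq.exists_eq (x : Rq d p) : ∃ a b : ℤ, x = a + b * Rq.sqrt d p := by
  obtain ⟨z, rfl⟩ := Ideal.Quotient.mk_surjective x
  refine ⟨z.re, z.im, ?_⟩
  conv_lhs => rw [show z = ⟨z.re, z.im⟩ from rfl, Zsqrtd.decompose]
  simp [Rq.sqrt, mul_comm]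

theorem Rq.add_mul_sqrt_eq_zero_iff (a b : ℤ) :
    (a + b * Rq.sqrt d p : Rq d p) = 0 ↔ (a : ZMod p) = 0 ∧ (b : ZMod p) = 0 := by
  have : (a + b * Rq.sqrt d p : Rq d p) = Ideal.Quotient.mk _ (⟨a, b⟩ : ℤ√(-d)) := by
    rw [Zsqrtd.decompose]
    simp [Rq.sqrt, mul_comm]
  rw [this, Rq.mk_eq_zero_iff, ZMod.intCast_zmod_eq_zero_iff_dvd,
    ZMod.intCast_zmod_eq_zero_iff_dvd]

/-- The homomorphism `ℤ[√-d]/(p) → ℤ/p` sending `√-d` to a given square root of `-d`. -/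
noncomputable def Rq.toZMod {r : ZMod p} (hr : r * r = ((-d : ℤ) : ZMod p)) : Rq d p →+* ZMod p :=
  Ideal.Quotient.lift _ (Zsqrtd.lift ⟨r, hr⟩) fun x hx => by
    rw [Ideal.mem_span_singleton] at hx
    obtain ⟨y, rfl⟩ := hx
    rw [map_mul, map_intCast]
    simp

theorem Rq.toZMod_sqrt {r : ZMod p} (hr : r * r = ((-d : ℤ) : ZMod p)) :
    Rq.toZMod d p hr (Rq.sqrt d p) = r := by
  simp [Rq.toZMod, Rq.sqrt]

theorem Rq.card : Nat.card (Rq d p) = p ^ 2 := by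
  let c := ZMod.castHom (dvd_refl p) (Rq d p)
  let g : ZMod p × ZMod p →+ Rq d p :=
    { toFun := fun x => c x.1 + c x.2 * Rq.sqrt d p
      map_zero' := by simp
      map_add' := fun x y => by simp only [Prod.fst_add, Prod.snd_add, map_add]; ring }
  have hg (a b : ℤ) : g (a, b) = a + b * Rq.sqrt d p := by simp [g, c]
  have hbij : Function.Bijective g := by
    constructor
    · rw [injective_iff_map_eq_zero]
      rintro ⟨a, b⟩ h
      obtain ⟨a, rfl⟩ := ZMod.intCast_surjective a
      obtain ⟨b, rfl⟩ := ZMod.intCast_surjective b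
      rw [hg, Rq.add_mul_sqrt_eq_zero_iff] at h
      exact Prod.ext h.1 h.2
    · intro x
      obtain ⟨a, b, rfl⟩ := Rq.exists_eq d p x
      exact ⟨(a, b), hg a b⟩
  rw [← Nat.card_congr (Equiv.ofBijective g hbij), Nat.card_prod, Nat.card_zmod, sq]

variable [Fact p.Prime]

theorem Rq.conjQ_eq_pow (hp2 : p ≠ 2) (h : legendreSym p (-d) = -1) (x : Rq d p) :
    conjQ d p x = x ^ p := by
  obtain ⟨a, b, rfl⟩ := Rq.exists_eq d p x
  have hc (a : ℤ) : (a : Rq d p) ^ p = a := by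
    have := congrArg (ZMod.castHom (dvd_refl p) (Rq d p)) (ZMod.pow_card (a : ZMod p))
    rwa [map_pow, map_intCast] at this
  have hs : Rq.sqrt d p ^ p = -Rq.sqrt d p := by
    have h1 := congrArg (ZMod.castHom (dvd_refl p) (Rq d p)) (legendreSym.eq_pow p (-d))
    rw [h, map_pow, map_intCast, map_intCast, ← Rq.sqrt_mul_sqrt, ← sq, ← pow_mul] at h1
    have h2 : p = 2 * (p / 2) + 1 := by
      have := (Fact.out : p.Prime).eq_two_or_odd
      omega
    calc Rq.sqrt d p ^ p = Rq.sqrt d p ^ (2 * (p / 2) + 1) := congrArg _ h2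
      _ = -Rq.sqrt d p := by rw [pow_succ, ← h1]; simp
  rw [add_pow_char, mul_pow, hc, hc, hs]
  simp [Rq.conjQ_sqrt]

theorem Rq.isField (h : legendreSym p (-d) = -1) : IsField (Rq d p) where
  exists_pair_ne := ⟨0, 1, by
    have := CharP.nontrivial_of_char_ne_one (R := Rq d p) (Fact.out : p.Prime).ne_one
    exact zero_ne_one⟩
  mul_comm := mul_comm
  mul_inv_cancel {x} hx := by
    obtain ⟨a, b, rfl⟩ := Rq.exists_eq d p x
    rw [Ne, Rq.add_mul_sqrt_eq_zero_iff] at hx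
    have hne : (a : ZMod p) ^ 2 + d * (b : ZMod p) ^ 2 ≠ 0 := by
      intro h0
      have hb : (b : ZMod p) ≠ 0 := by
        intro hb
        refine hx ⟨?_, hb⟩
        simpa [hb] using h0
      rw [legendreSym.eq_neg_one_iff] at h
      refine h ⟨a / b, ?_⟩
      field_simp
      push_cast
      linear_combination -h0
    let c := ZMod.castHom (dvd_refl p) (Rq d p)
    have h1 : c ((a : ZMod p) ^ 2 + d * (b : ZMod p) ^ 2) *
        c ((a : ZMod p) ^ 2 + d * (b : ZMod p) ^ 2)⁻¹ = 1 := by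
      rw [← map_mul, mul_inv_cancel₀ hne, map_one]
    refine ⟨(a - b * Rq.sqrt d p) * c ((a : ZMod p) ^ 2 + d * (b : ZMod p) ^ 2)⁻¹, ?_⟩
    rw [← mul_assoc, ← h1]
    congr 1
    have hs := Rq.sqrt_mul_sqrt d p
    push_cast at hs
    simp only [c, map_add, map_mul, map_pow, map_intCast]
    linear_combination - (b : Rq d p) ^ 2 * hs

end Rq

section Hermitian

variable {K : Type*} [Field K] [StarRing K]

theorem card_unitary [Finite K] {q : ℕ} (hq : Nat.card K = q ^ 2)
    (hstar : ∀ x : K, star x = x ^ q) (h2 : (2 : K) ≠ 0) (N : ℕ) :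
    (Nat.card {A : Matrix (Fin N) (Fin N) K // A * Aᴴ = 1} : ℤ) =
      ∏ i ∈ Finset.range N, (q : ℤ) ^ i * ((q : ℤ) ^ (i + 1) - (-1) ^ (i + 1)) := by
  classical
  have hq0 : (q : ℤ) ≠ 0 := by
    rintro h
    rw [Nat.cast_eq_zero.1 h] at hq
    exact Nat.card_pos.ne' (hq.trans (zero_pow two_ne_zero))
  induction N with
  | zero => simp [Nat.card_unique, Subsingleton.elim _ (1 : Matrix (Fin 0) (Fin 0) K)]
  | succ N ih =>
    have e : Unit ⊕ Fin N ≃ Fin (N + 1) := Fintype.equivFinOfCardEq (by simp [add_comm])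
    have he : Nat.card {v : Unit ⊕ Fin N → K // v ⬝ᵥ star v = 1} =
        Nat.card {v : Fin (N + 1) → K // v ⬝ᵥ star v = 1} :=
      Nat.card_congr <| (e.arrowCongr (Equiv.refl K)).subtypeEquiv fun v => by
        rw [← comp_equiv_dotProduct_comp_equiv _ _ e]
        simp [Function.comp_def, Pi.star_def]
    rw [← card_unitary_reindex e, card_unitary_succ h2, he, Nat.cast_mul, ih,
      Finset.prod_range_succ, mul_comm]
    congr 1
    have := card_dotProduct_star_eq hq hstar (N + 1) 1 (star_one K)
    rw [if_neg one_ne_zero] at this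
    apply mul_left_cancel₀ hq0
    rw [this, neg_pow]
    ring

theorem card_SU_field [Finite K] {q : ℕ} (hq : Nat.card K = q ^ 2)
    (hstar : ∀ x : K, star x = x ^ q) (h2 : (2 : K) ≠ 0) (n : ℕ) :
    ((q : ℤ) + 1) * Nat.card {A : Matrix (Fin (n + 1)) (Fin (n + 1)) K //
        A * Lmat K n * Aᴴ = Lmat K n ∧ A.det = 1} =
      ∏ i ∈ Finset.range (n + 1), (q : ℤ) ^ i * ((q : ℤ) ^ (i + 1) - (-1) ^ (i + 1)) := by
  rw [← card_unitary hq hstar h2, card_unitary_eq_card_special_unitary_mul]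
  have hnorm (t : K) (ht0 : t ≠ 0) (ht : star t = t) :
      Nat.card {x : K // x * star x = t} = q + 1 := by
    rw [← FiniteField.card_mul_pow_eq hq ht0 (by rw [← hstar, ht])]
    simp only [hstar]
  rw [hnorm 1 one_ne_zero (star_one K)]
  obtain ⟨c, hc⟩ : ∃ c : K, c * star c = -1 := by
    have h := hnorm (-1) (by simp) (by simp)
    have : Nonempty {x : K // x * star x = -1} := (Nat.card_pos_iff.1 (by omega)).1
    exact ⟨this.some.1, this.some.2⟩
  let D : Matrix (Fin (n + 1)) (Fin (n + 1)) K :=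
    diagonal fun i => if i = Fin.last n then c else 1
  have hD : D * Dᴴ = Lmat K n := by
    simp only [D, Lmat, diagonal_conjTranspose, diagonal_mul_diagonal]
    congr 1
    ext i
    by_cases h : i = Fin.last n <;> simp [h, hc]
  have hDu : IsUnit D.det := by
    have := congrArg det (Lmat_mul_self K n)
    rw [← hD, det_mul, det_mul, det_one, mul_assoc] at this
    exact IsUnit.of_mul_eq_one _ this
  have hD1 := Matrix.mul_nonsing_inv D hDu
  have hD2 := Matrix.nonsing_inv_mul D hDu
  have hD1' : D⁻¹ᴴ * Dᴴ = 1 := by rw [← conjTranspose_mul, hD1, conjTranspose_one]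
  have hD2' : Dᴴ * D⁻¹ᴴ = 1 := by rw [← conjTranspose_mul, hD2, conjTranspose_one]
  push_cast
  congr 2
  symm
  refine Nat.card_congr
    { toFun := fun A => ⟨D * A.1 * D⁻¹, ?_, ?_⟩
      invFun := fun A => ⟨D⁻¹ * A.1 * D, ?_, ?_⟩
      left_inv := fun A => ?_
      right_inv := fun A => ?_ }
  · calc D * A.1 * D⁻¹ * Lmat K n * (D * A.1 * D⁻¹)ᴴ
        = D * A.1 * (D⁻¹ * D) * (Dᴴ * D⁻¹ᴴ) * A.1ᴴ * Dᴴ := by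
          rw [← hD, conjTranspose_mul, conjTranspose_mul]; simp only [mul_assoc]
      _ = D * (A.1 * A.1ᴴ) * Dᴴ := by rw [hD2, hD2']; simp only [mul_assoc, mul_one]
      _ = Lmat K n := by rw [A.2.1, mul_one, hD]
  · rw [det_mul, mul_comm, ← det_mul, ← mul_assoc, hD2, one_mul, A.2.2]
  · calc D⁻¹ * A.1 * D * (D⁻¹ * A.1 * D)ᴴ
        = D⁻¹ * (A.1 * (D * Dᴴ) * A.1ᴴ) * D⁻¹ᴴ := by
          rw [conjTranspose_mul, conjTranspose_mul]; simp only [mul_assoc]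
      _ = (D⁻¹ * D) * (Dᴴ * D⁻¹ᴴ) := by rw [hD, A.2.1, ← hD]; simp only [mul_assoc]
      _ = 1 := by rw [hD2, hD2', one_mul]
  · rw [det_mul, mul_comm, ← det_mul, ← mul_assoc, hD1, one_mul, A.2.2]
  · ext1
    calc D⁻¹ * (D * A.1 * D⁻¹) * D = (D⁻¹ * D) * A.1 * (D⁻¹ * D) := by simp only [mul_assoc]
      _ = A.1 := by rw [hD2, one_mul, mul_one]
  · ext1
    calc D * (D⁻¹ * A.1 * D) * D⁻¹ = (D * D⁻¹) * A.1 * (D * D⁻¹) := by simp only [mul_assoc]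
      _ = A.1 := by rw [hD1, one_mul, mul_one]

end Hermitian

theorem card_SU_L_of_legendreSym_eq_neg_one (d : ℤ) (n p : ℕ) [Fact p.Prime] (hp2 : p ≠ 2)
    (h : legendreSym p (-d) = -1) :
    ((p : ℤ) + 1) * Nat.card {A : Matrix (Fin (n + 1)) (Fin (n + 1)) (Rq d p) //
        A * Lmat (Rq d p) n * (A.map (conjQ d p))ᵀ = Lmat (Rq d p) n ∧ A.det = 1} =
      ∏ i ∈ Finset.range (n + 1), (p : ℤ) ^ i * ((p : ℤ) ^ (i + 1) - (-1) ^ (i + 1)) := by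
  let : Field (Rq d p) := (Rq.isField d p h).toField
  let : StarRing (Rq d p) :=
    { star := conjQ d p
      star_involutive := fun x => by
        obtain ⟨a, b, rfl⟩ := Rq.exists_eq d p x
        simp [Rq.conjQ_sqrt]
      star_mul := fun x y => by rw [map_mul, mul_comm]
      star_add := map_add _ }
  have hp := (Fact.out : p.Prime)
  have : Finite (Rq d p) := Nat.finite_of_card_ne_zero (by
    rw [Rq.card]; exact pow_ne_zero 2 hp.ne_zero)
  refine card_SU_field (Rq.card d p) (Rq.conjQ_eq_pow d p hp2 h) ?_ n
  intro h0
  have h1 := (CharP.cast_eq_zero_iff (Rq d p) p 2).1 (by exact_mod_cast h0)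
  exact hp2 ((Nat.prime_dvd_prime_iff_eq hp Nat.prime_two).1 h1)

theorem card_SU_L_of_legendreSym_eq_one (d : ℤ) (n p : ℕ) [Fact p.Prime] (hp2 : p ≠ 2)
    (hpd : ((-d : ℤ) : ZMod p) ≠ 0) (h : legendreSym p (-d) = 1) :
    ((p : ℤ) - 1) * Nat.card {A : Matrix (Fin (n + 1)) (Fin (n + 1)) (Rq d p) //
        A * Lmat (Rq d p) n * (A.map (conjQ d p))ᵀ = Lmat (Rq d p) n ∧ A.det = 1} =
      ∏ i ∈ Finset.range (n + 1), (p : ℤ) ^ i * ((p : ℤ) ^ (i + 1) - 1) := by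
  have hp := (Fact.out : p.Prime)
  have h2 : (2 : ZMod p) ≠ 0 := by
    intro h0
    have h1 := (CharP.cast_eq_zero_iff (ZMod p) p 2).1 (by exact_mod_cast h0)
    exact hp2 ((Nat.prime_dvd_prime_iff_eq hp Nat.prime_two).1 h1)
  obtain ⟨r, hr⟩ := (legendreSym.eq_one_iff p hpd).1 h
  have hr' : -r * -r = ((-d : ℤ) : ZMod p) := by rw [neg_mul_neg, hr]
  have hr0 : r ≠ 0 := by
    rintro rfl
    exact hpd (by rw [hr, mul_zero])
  have key := card_det_eq_one_mul (F := ZMod p) n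
  rw [Nat.card_zmod] at key
  rw [← key, card_SU_split (conjQ d p) (Rq.toZMod d p hr.symm) (Rq.toZMod d p hr')]
  · intro x
    obtain ⟨a, b, rfl⟩ := Rq.exists_eq d p x
    simp [Rq.conjQ_sqrt, Rq.toZMod_sqrt]
  · intro x
    obtain ⟨a, b, rfl⟩ := Rq.exists_eq d p x
    simp [Rq.conjQ_sqrt, Rq.toZMod_sqrt]
  · intro x y hx hy
    rw [← sub_eq_zero] at hx hy ⊢
    rw [← map_sub] at hx hy
    obtain ⟨a, b, hab⟩ := Rq.exists_eq d p (x - y)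
    rw [hab] at hx hy ⊢
    simp only [map_add, map_mul, map_intCast, Rq.toZMod_sqrt] at hx hy
    rw [Rq.add_mul_sqrt_eq_zero_iff]
    have ha : (2 : ZMod p) * a = 0 := by linear_combination hx + hy
    have hb : (2 * r : ZMod p) * b = 0 := by linear_combination hx - hy
    exact ⟨(mul_eq_zero.1 ha).resolve_left h2,
      (mul_eq_zero.1 hb).resolve_left (mul_ne_zero h2 hr0)⟩
  · intro a b
    obtain ⟨u, hu⟩ := ZMod.intCast_surjective ((a + b) / 2)
    obtain ⟨v, hv⟩ := ZMod.intCast_surjective ((a - b) / (2 * r))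
    refine ⟨u + v * Rq.sqrt d p, ?_, ?_⟩ <;>
    · simp only [map_add, map_mul, map_intCast, Rq.toZMod_sqrt, hu, hv]
      field_simp
      ring

/-- For an odd prime `p ∤ d`, the order of `SU(L, ℤ[√-d]/(p))` equals
`p^{n(n+1)/2} · ∏_{i=2}^{n+1} (p^i - χ^i)`, where `χ = (-d/p)`. -/
theorem card_SU_L_mod_p_unramified (d : ℤ) (hd : 0 < d) (hodd : Odd d)
    (hsf : Squarefree d) (n : ℕ) (hn : 1 ≤ n) (p : ℕ) [Fact p.Prime] (hp2 : p ≠ 2)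
    (hpd : ¬ (p : ℤ) ∣ d) :
    (Nat.card {A : Matrix (Fin (n + 1)) (Fin (n + 1)) (Rq d p) //
        A * Lmat (Rq d p) n * (A.map (conjQ d p))ᵀ = Lmat (Rq d p) n ∧
        A.det = 1} : ℤ)
      = p ^ (n * (n + 1) / 2) *
        ∏ i ∈ Finset.Icc 2 (n + 1), ((p : ℤ) ^ i - (legendreSym p (-d)) ^ i) := by
  have hp1 : (1 : ℤ) < p := by exact_mod_cast (Fact.out : p.Prime).one_lt
  have hd0 : ((-d : ℤ) : ZMod p) ≠ 0 := by
    rwa [Ne, ZMod.intCast_zmod_eq_zero_iff_dvd, dvd_neg]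
  rcases legendreSym.eq_one_or_neg_one p hd0 with h | h
  · have h1 := card_SU_L_of_legendreSym_eq_one d n p hp2 hd0 h
    have h2 := prod_range_mul_pow_sub p 1 n
    simp only [one_pow] at h2
    rw [h2] at h1
    simpa [h] using mul_left_cancel₀ (by omega) h1
  · have h1 := card_SU_L_of_legendreSym_eq_neg_one d n p hp2 h
    rw [prod_range_mul_pow_sub, sub_neg_eq_add] at h1
    rw [h]
    exact mul_left_cancel₀ (by omega) h1
end

section
/- Let d be a positive odd squarefree integer, n ≥ 2 even, and p an odd prime with p ∣ d. Let R = ℤ[√-d]/(p) with σ the ring endomorphism induced by conjugation, and let L = diag(1,…,1,-1) of size n+1. Then the number N of matrices A ∈ M_{n+1}(R) with A·L·σ(A)ᵀ = L and det A = 1 satisfies, as rational numbers, N = p^{(n+1)²-1} · ∏_{i=1}^{n/2} (1 - p^{-2i}). -/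
open Matrix

section CountingDiagonalForms

variable {F : Type*} [Field F] [Fintype F] [DecidableEq F]

theorem card_mul_sq_eq (hF : ringChar F ≠ 2) {a : F} (ha : a ≠ 0) (s : F) :
    (Fintype.card {x : F // a * x ^ 2 = s} : ℤ) = 1 + quadraticChar F (a * s) := by
  have h := quadraticChar_card_sqrts hF (a⁻¹ * s)
  have h2 : quadraticChar F (a * s) = quadraticChar F (a⁻¹ * s) := by
    rw [show a * s = a ^ 2 * (a⁻¹ * s) by field_simp, map_mul, quadraticChar_sq_one' ha, one_mul]
  rw [h2, add_comm, ← h, Fintype.card_subtype, Set.toFinset_card, Fintype.card_subtype]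
  congr 2
  ext x
  simp only [Finset.mem_filter, Finset.mem_univ, true_and, Set.mem_ofPred_eq]
  rw [eq_inv_mul_iff_mul_eq₀ ha]

theorem sum_quadraticChar_mul_sub (hF : ringChar F ≠ 2) (c : F) :
    ∑ s : F, quadraticChar F s * quadraticChar F (c - s) =
      quadraticChar F (-1) * ((if c = 0 then (Fintype.card F : ℤ) else 0) - 1) := by
  split_ifs with hc
  · subst hc
    have : ∀ s : F, quadraticChar F s * quadraticChar F (0 - s) =
        quadraticChar F (-1) * (if s ∈ Finset.univ.erase (0 : F) then 1 else 0) := by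
      intro s
      rcases eq_or_ne s 0 with rfl | hs
      · simp
      · rw [← map_mul, show s * (0 - s) = -1 * s ^ 2 by ring, map_mul, quadraticChar_sq_one' hs]
        simp [hs]
    rw [Finset.sum_congr rfl fun s _ => this s, ← Finset.mul_sum, Finset.sum_ite_mem]
    simp [Finset.card_erase_of_mem, Nat.cast_sub Fintype.card_pos]
  · have h := jacobiSum_nontrivial_inv (quadraticChar_ne_one hF)
    rw [(quadraticChar_isQuadratic F).inv] at h
    rw [zero_sub, mul_neg_one, ← h, jacobiSum]
    rw [← Equiv.sum_comp (Equiv.mulLeft₀ c hc)]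
    refine Finset.sum_congr rfl fun s _ => ?_
    simp only [Equiv.mulLeft₀_apply]
    rw [← map_mul, ← map_mul, show c * s * (c - c * s) = c ^ 2 * (s * (1 - s)) by ring, map_mul,
      quadraticChar_sq_one' hc, one_mul]

theorem card_binary_form_eq (hF : ringChar F ≠ 2) {a b : F} (ha : a ≠ 0) (hb : b ≠ 0) (c : F) :
    (Fintype.card {x : F × F // a * x.1 ^ 2 + b * x.2 ^ 2 = c} : ℤ) =
      Fintype.card F - quadraticChar F (-1 * (a * b)) +
        if c = 0 then Fintype.card F * quadraticChar F (-1 * (a * b)) else 0 := by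
  let e : {x : F × F // a * x.1 ^ 2 + b * x.2 ^ 2 = c} ≃
      Σ s : F, {x : F // a * x ^ 2 = s} × {y : F // b * y ^ 2 = c - s} :=
    { toFun := fun x => ⟨a * x.1.1 ^ 2, ⟨x.1.1, rfl⟩, ⟨x.1.2, eq_sub_of_add_eq' x.2⟩⟩
      invFun := fun y => ⟨(y.2.1.1, y.2.2.1), by
        have h1 := y.2.1.2
        have h2 := y.2.2.2
        simp only [h1, h2]; ring⟩
      left_inv := fun x => rfl
      right_inv := by
        rintro ⟨s, ⟨x, rfl⟩, y, hy⟩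
        rfl }
  have h0 : ∑ s : F, quadraticChar F s = 0 := quadraticChar_sum_zero hF
  have h0' : ∑ s : F, quadraticChar F (c - s) = 0 := by
    rw [← h0]
    exact (Equiv.subLeft c).sum_comp fun s => quadraticChar F s
  rw [Fintype.card_congr e, Fintype.card_sigma]
  simp only [Fintype.card_prod]
  push_cast
  simp only [card_mul_sq_eq hF ha, card_mul_sq_eq hF hb, map_mul]
  have : ∀ s : F, (1 + quadraticChar F a * quadraticChar F s) *
      (1 + quadraticChar F b * quadraticChar F (c - s)) =
      1 + quadraticChar F a * quadraticChar F s + quadraticChar F b * quadraticChar F (c - s) +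
      quadraticChar F a * quadraticChar F b * (quadraticChar F s * quadraticChar F (c - s)) := by
    intro s; ring
  simp only [this, Finset.sum_add_distrib, ← Finset.mul_sum, h0, h0',
    sum_quadraticChar_mul_sub hF]
  split_ifs <;> simp <;> ring

/-- The number of solutions of `∑ wᵢ xᵢ² = c`. -/
def diagFormCard {m : ℕ} (w : Fin m → F) (c : F) : ℕ :=
  Fintype.card {x : Fin m → F // ∑ i, w i * x i ^ 2 = c}

theorem diagFormCard_add_two (hF : ringChar F ≠ 2) {m : ℕ} (w : Fin (m + 2) → F)
    (hw : ∀ i, w i ≠ 0) (c : F) :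
    (diagFormCard w c : ℤ) =
      (Fintype.card F - quadraticChar F (-1 * (w 0 * w 1))) * Fintype.card F ^ m +
        Fintype.card F * quadraticChar F (-1 * (w 0 * w 1)) *
          diagFormCard (fun i : Fin m => w i.succ.succ) c := by
  let e : {x : Fin (m + 2) → F // ∑ i, w i * x i ^ 2 = c} ≃
      Σ z : Fin m → F, {x : F × F // w 0 * x.1 ^ 2 + w 1 * x.2 ^ 2 =
        c - ∑ i, w i.succ.succ * z i ^ 2} :=
    { toFun := fun x => ⟨fun i => x.1 i.succ.succ, (x.1 0, x.1 1), by
        have h := x.2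
        rw [Fin.sum_univ_succ, Fin.sum_univ_succ, ← add_assoc] at h
        exact eq_sub_of_add_eq h⟩
      invFun := fun y => ⟨Fin.cons y.2.1.1 (Fin.cons y.2.1.2 y.1), by
        have h := y.2.2
        rw [Fin.sum_univ_succ, Fin.sum_univ_succ]
        simp only [Fin.cons_zero, Fin.cons_succ]
        rw [← add_assoc]
        exact (eq_sub_iff_add_eq.1 h)⟩
      left_inv := by
        rintro ⟨x, hx⟩
        ext i
        refine Fin.cases rfl (fun i => Fin.cases rfl (fun i => rfl) i) i
      right_inv := by
        rintro ⟨z, ⟨x, y⟩, h⟩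
        rfl }
  rw [diagFormCard, Fintype.card_congr e, Fintype.card_sigma, Nat.cast_sum,
    Finset.sum_congr rfl fun z _ => card_binary_form_eq hF (hw 0) (hw 1) _,
    Finset.sum_add_distrib, ← Finset.sum_filter, Finset.sum_const, Finset.sum_const,
    diagFormCard, Fintype.card_subtype]
  simp only [sub_eq_zero, @eq_comm _ c, Finset.card_univ, Fintype.card_fun, Fintype.card_fin,
    nsmul_eq_mul]
  push_cast
  ring

theorem card_mul_diagFormCard_even (hF : ringChar F ≠ 2) (k : ℕ) (w : Fin (2 * k) → F)
    (hw : ∀ i, w i ≠ 0) {c : F} (hc : c ≠ 0) :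
    (Fintype.card F * diagFormCard w c : ℤ) = Fintype.card F ^ (2 * k) -
      Fintype.card F ^ k * quadraticChar F ((-1) ^ k * ∏ i, w i) := by
  induction k with
  | zero =>
    have : IsEmpty (Fin (2 * 0)) := Fin.isEmpty
    have : diagFormCard w c = 0 := by
      rw [diagFormCard, Fintype.card_eq_zero_iff]
      refine ⟨fun x => hc ?_⟩
      rw [← x.2]
      exact Fintype.sum_empty _
    rw [this]
    simp
  | succ k ih =>
    have h := diagFormCard_add_two (m := 2 * k) hF w hw c
    have h' := ih (fun i => w i.succ.succ) fun i => hw _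
    have hp : ∏ i, w i = w 0 * (w 1 * ∏ i : Fin (2 * k), w i.succ.succ) :=
      (Fin.prod_univ_succ (n := 2 * k + 1) w).trans
        (congrArg (w 0 * ·) (Fin.prod_univ_succ (n := 2 * k) _))
    have hs : (-1) ^ (k + 1) * ∏ i, w i =
        (-1 * (w 0 * w 1)) * ((-1) ^ k * ∏ i : Fin (2 * k), w i.succ.succ) := by
      rw [hp]; ring
    rw [hs, map_mul]
    set ε := quadraticChar F (-1 * (w 0 * w 1))
    rw [mul_add] at *
    rw [h]
    linear_combination (Fintype.card F * ε : ℤ) * h'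

theorem diagFormCard_odd (hF : ringChar F ≠ 2) (k : ℕ) (w : Fin (2 * k + 1) → F)
    (hw : ∀ i, w i ≠ 0) (c : F) :
    (diagFormCard w c : ℤ) = Fintype.card F ^ (2 * k) +
      Fintype.card F ^ k * quadraticChar F ((-1) ^ k * (c * ∏ i, w i)) := by
  induction k with
  | zero =>
    have : diagFormCard w c = Fintype.card {x : F // w 0 * x ^ 2 = c} := by
      refine Fintype.card_congr ((Equiv.funUnique (Fin 1) F).subtypeEquiv fun x => ?_)
      rw [Fin.sum_univ_succ (n := 0)]
      simp
    rw [this, card_mul_sq_eq hF (hw 0)]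
    simp [mul_comm]
  | succ k ih =>
    have h := diagFormCard_add_two (m := 2 * k + 1) hF w hw c
    have h' := ih (fun i => w i.succ.succ) fun i => hw _
    have hp : ∏ i, w i = w 0 * (w 1 * ∏ i : Fin (2 * k + 1), w i.succ.succ) :=
      (Fin.prod_univ_succ (n := 2 * k + 2) w).trans
        (congrArg (w 0 * ·) (Fin.prod_univ_succ (n := 2 * k + 1) _))
    have hs : (-1) ^ (k + 1) * (c * ∏ i, w i) =
        (-1 * (w 0 * w 1)) * ((-1) ^ k * (c * ∏ i : Fin (2 * k + 1), w i.succ.succ)) := by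
      rw [hp]; ring
    rw [hs, map_mul]
    set ε := quadraticChar F (-1 * (w 0 * w 1))
    rw [h]
    linear_combination (Fintype.card F * ε : ℤ) * h'

theorem diagFormCard_mul_diagFormCard_tail (hF : ringChar F ≠ 2) (k : ℕ)
    (w : Fin (2 * k + 1) → F) (hw : ∀ i, w i ≠ 0) {c : F} (hc : c ≠ 0) :
    (Fintype.card F * (diagFormCard w (w 0) * diagFormCard (fun i => w (Fin.succ i)) c) : ℤ) =
      Fintype.card F ^ (2 * k) * (Fintype.card F ^ (2 * k) - 1) := by
  have h1 := diagFormCard_odd hF k w hw (w 0)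
  have h2 := card_mul_diagFormCard_even hF k (fun i => w (Fin.succ i)) (fun i => hw _) hc
  have h3 : (-1) ^ k * (w 0 * ∏ i, w i) =
      w 0 ^ 2 * ((-1) ^ k * ∏ i : Fin (2 * k), w i.succ) := by
    rw [Fin.prod_univ_succ]; ring
  rw [h3, map_mul, quadraticChar_sq_one' (hw 0), one_mul] at h1
  have h4 : quadraticChar F ((-1) ^ k * ∏ i : Fin (2 * k), w i.succ) ^ 2 = 1 :=
    quadraticChar_sq_one (mul_ne_zero (pow_ne_zero _ (neg_ne_zero.2 one_ne_zero))
      (Finset.prod_ne_zero_iff.2 fun i _ => hw _))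
  rw [mul_left_comm, h2, h1]
  linear_combination (-(Fintype.card F : ℤ) ^ (2 * k)) * h4

end CountingDiagonalForms

section OrthogonalGroup

variable {F : Type*} [Field F]

/-- The matrices preserving the diagonal form with coefficients `w`, acting on row vectors. -/
def diagOrth {ι : Type*} [Fintype ι] [DecidableEq ι] (w : ι → F) : Set (Matrix ι ι F) :=
  {X | X * diagonal w * Xᵀ = diagonal w}

section

variable {ι : Type*} [Fintype ι] [DecidableEq ι] {w : ι → F}

theorem mem_diagOrth_iff {X : Matrix ι ι F} :
    X ∈ diagOrth w ↔ ∀ i j, ∑ l, X i l * w l * X j l = if i = j then w i else 0 := by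
  rw [diagOrth, Set.mem_ofPred_eq, ← Matrix.ext_iff]
  simp [Matrix.mul_apply, diagonal_apply]

theorem diagOrth_mul {X Y : Matrix ι ι F} (hX : X ∈ diagOrth w) (hY : Y ∈ diagOrth w) :
    X * Y ∈ diagOrth w := by
  change X * Y * diagonal w * (X * Y)ᵀ = diagonal w
  rw [transpose_mul, show X * Y * diagonal w * (Yᵀ * Xᵀ) = X * (Y * diagonal w * Yᵀ) * Xᵀ by
    simp only [Matrix.mul_assoc], hY, hX]

theorem diagOrth_neg {X : Matrix ι ι F} (hX : X ∈ diagOrth w) : -X ∈ diagOrth w := by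
  change -X * diagonal w * (-X)ᵀ = diagonal w
  rw [transpose_neg, neg_mul, neg_mul_neg, hX]

theorem det_sq_of_mem_diagOrth (hw : ∀ i, w i ≠ 0) {X : Matrix ι ι F} (hX : X ∈ diagOrth w) :
    X.det ^ 2 = 1 := by
  have h := congrArg det (show X * diagonal w * Xᵀ = diagonal w from hX)
  have h0 : (diagonal w).det ≠ 0 := by
    rw [det_diagonal]
    exact Finset.prod_ne_zero_iff.2 fun i _ => hw i
  rw [det_mul, det_mul, det_transpose] at h
  apply mul_right_cancel₀ h0
  rw [one_mul]
  linear_combination h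

theorem isUnit_det_of_mem_diagOrth (hw : ∀ i, w i ≠ 0) {X : Matrix ι ι F}
    (hX : X ∈ diagOrth w) : IsUnit X.det :=
  .of_mul_eq_one X.det (by rw [← sq, det_sq_of_mem_diagOrth hw hX])

theorem diagOrth_inv (hw : ∀ i, w i ≠ 0) {X : Matrix ι ι F} (hX : X ∈ diagOrth w) :
    X⁻¹ ∈ diagOrth w := by
  have h := isUnit_det_of_mem_diagOrth hw hX
  change X⁻¹ * diagonal w * X⁻¹ᵀ = diagonal w
  conv_lhs => rw [← show X * diagonal w * Xᵀ = diagonal w from hX]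
  rw [show X⁻¹ * (X * diagonal w * Xᵀ) * X⁻¹ᵀ = X⁻¹ * X * diagonal w * (X⁻¹ * X)ᵀ by
    rw [transpose_mul]; simp only [Matrix.mul_assoc], nonsing_inv_mul _ h]
  simp

/-- The reflection in the hyperplane orthogonal to `u`, acting on row vectors. -/
def diagReflection (w u : ι → F) : Matrix ι ι F :=
  1 - (2 / ∑ l, w l * u l ^ 2) • vecMulVec (w * u) u

theorem diagReflection_mem {u : ι → F} (hu : ∑ l, w l * u l ^ 2 ≠ 0) :
    diagReflection w u ∈ diagOrth w := by
  set b := ∑ l, w l * u l ^ 2 with hb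
  have h1 : vecMulVec (w * u) u * diagonal w = vecMulVec (w * u) (w * u) := by
    ext i j
    simp [vecMulVec_apply]
    ring
  have h2 : diagonal w * (vecMulVec (w * u) u)ᵀ = vecMulVec (w * u) (w * u) := by
    ext i j
    simp [vecMulVec_apply]
    ring
  have h3 : vecMulVec (w * u) (w * u) * (vecMulVec (w * u) u)ᵀ =
      b • vecMulVec (w * u) (w * u) := by
    ext i j
    simp only [Matrix.mul_apply, vecMulVec_apply, transpose_apply, Pi.mul_apply, Matrix.smul_apply,
      smul_eq_mul, hb, Finset.sum_mul]
    exact Finset.sum_congr rfl fun l _ => by ring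
  change diagReflection w u * diagonal w * (diagReflection w u)ᵀ = diagonal w
  rw [diagReflection, ← hb, transpose_sub, transpose_one, transpose_smul, sub_mul, one_mul,
    smul_mul_assoc, h1, sub_mul, mul_sub, mul_one, mul_sub, mul_one, mul_smul_comm, h2,
    smul_mul_assoc, mul_smul_comm, h3, smul_smul, smul_smul]
  rw [show 2 / b * (2 / b) * b = 2 / b + 2 / b by field_simp; ring, add_smul]
  abel

theorem exists_mem_diagOrth_row_eq (h2 : (2 : F) ≠ 0) (hw : ∀ i, w i ≠ 0) (i₀ : ι) {x : ι → F}
    (hx : ∑ l, w l * x l ^ 2 = w i₀) : ∃ Y ∈ diagOrth w, Y i₀ = x := by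
  have hrow : ∀ u : ι → F, ∀ j, diagReflection w u i₀ j =
      (Pi.single i₀ 1 : ι → F) j - 2 / (∑ l, w l * u l ^ 2) * (w i₀ * u i₀ * u j) := by
    intro u j
    simp [diagReflection, vecMulVec_apply, Matrix.one_apply, Pi.single_apply, eq_comm]
  have hsum : ∀ t : F, t ^ 2 = 1 → ∑ l, w l * (x - t • Pi.single i₀ 1 : ι → F) l ^ 2 =
      2 * w i₀ * (1 - t * x i₀) := by
    intro t ht
    have : ∀ l, w l * (x - t • Pi.single i₀ 1 : ι → F) l ^ 2 =
        w l * x l ^ 2 + if l = i₀ then w l - 2 * t * w l * x l else 0 := by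
      intro l
      by_cases h : l = i₀
      · subst h; simp; linear_combination w l * ht
      · simp [h]
    rw [Finset.sum_congr rfl fun l _ => this l, Finset.sum_add_distrib, hx]
    simp
    ring
  by_cases h : x i₀ = 1
  · have hb := hsum (-1) (by ring)
    rw [h, show 2 * w i₀ * (1 - -1 * 1) = 2 * 2 * w i₀ by ring] at hb
    have hb0 : 2 * 2 * w i₀ ≠ 0 := mul_ne_zero (mul_ne_zero h2 h2) (hw _)
    refine ⟨_, diagOrth_neg (diagReflection_mem (hb ▸ hb0)), funext fun j => ?_⟩
    rw [neg_apply, hrow, hb]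
    have := hw i₀
    by_cases hj : j = i₀
    · subst hj
      simp [h]
      field_simp
      ring
    · simp [h, hj]
      field_simp
      ring
  · have hb := hsum 1 (by ring)
    have h1 : 1 - 1 * x i₀ ≠ 0 := by rw [one_mul]; exact sub_ne_zero.2 (Ne.symm h)
    have hb0 : 2 * w i₀ * (1 - 1 * x i₀) ≠ 0 := mul_ne_zero (mul_ne_zero h2 (hw _)) h1
    refine ⟨_, diagReflection_mem (hb ▸ hb0), funext fun j => ?_⟩
    rw [hrow, hb]
    have := hw i₀
    rw [one_mul] at h1
    by_cases hj : j = i₀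
    · subst hj
      simp
      field_simp
      ring
    · simp [hj]
      field_simp
      ring

theorem sum_mul_row_sq_of_mem_diagOrth {X : Matrix ι ι F} (hX : X ∈ diagOrth w) (i : ι) :
    ∑ l, w l * X i l ^ 2 = w i := by
  have h := mem_diagOrth_iff.1 hX i i
  rw [if_pos rfl] at h
  rw [← h]
  exact Finset.sum_congr rfl fun l _ => by ring

/-- The elements of `diagOrth w` with a given row are in bijection with those having a standard
basis vector as that row. -/
noncomputable def diagOrthRowEquiv (hw : ∀ i, w i ≠ 0) {Y : Matrix ι ι F} (hY : Y ∈ diagOrth w) (i₀ : ι) :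
    {X // X ∈ diagOrth w ∧ X i₀ = Pi.single i₀ 1} ≃ {X // X ∈ diagOrth w ∧ X i₀ = Y i₀} where
  toFun X := ⟨X.1 * Y, diagOrth_mul X.2.1 hY, by
    rw [Matrix.mul_apply_eq_vecMul, X.2.2, single_one_vecMul]; rfl⟩
  invFun X := ⟨X.1 * Y⁻¹, diagOrth_mul X.2.1 (diagOrth_inv hw hY), by
    rw [Matrix.mul_apply_eq_vecMul, X.2.2, ← Matrix.mul_apply_eq_vecMul,
      mul_nonsing_inv _ (isUnit_det_of_mem_diagOrth hw hY)]
    ext j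
    simp [Matrix.one_apply, Pi.single_apply, eq_comm]⟩
  left_inv X := Subtype.ext
    (mul_nonsing_inv_cancel_right _ _ (isUnit_det_of_mem_diagOrth hw hY))
  right_inv X := Subtype.ext
    (nonsing_inv_mul_cancel_right _ _ (isUnit_det_of_mem_diagOrth hw hY))

end

/-- Elements of `diagOrth w` fixing the first basis vector are the same as elements of `diagOrth`
of the remaining coefficients. -/
def diagOrthStabilizerEquiv {m : ℕ} {w : Fin (m + 1) → F} (hw : ∀ i, w i ≠ 0) :
    {X // X ∈ diagOrth w ∧ X 0 = Pi.single 0 1} ≃ diagOrth fun i => w (Fin.succ i) where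
  toFun X := ⟨X.1.submatrix Fin.succ Fin.succ, by
    have h := mem_diagOrth_iff.1 X.2.1
    refine mem_diagOrth_iff.2 fun i j => ?_
    have h0 : ∀ i : Fin m, X.1 i.succ 0 = 0 := by
      intro i
      have := h i.succ 0
      rw [X.2.2] at this
      simpa [Pi.single_apply, hw 0] using this
    have := h i.succ j.succ
    rw [Fin.sum_univ_succ, h0 i] at this
    simpa using this⟩
  invFun Z := ⟨of (Fin.cons (Pi.single 0 1) fun i => Fin.cons 0 (Z.1 i)), by
    have h := mem_diagOrth_iff.1 Z.2
    refine ⟨mem_diagOrth_iff.2 fun i j => ?_, rfl⟩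
    rw [Fin.sum_univ_succ]
    refine Fin.cases ?_ (fun i => ?_) i <;> refine Fin.cases ?_ (fun j => ?_) j
    · simp
    · simp [(Fin.succ_ne_zero j).symm]
    · simp
    · simpa using h i j⟩
  left_inv X := by
    have h := mem_diagOrth_iff.1 X.2.1
    ext i j
    refine Fin.cases ?_ (fun i => ?_) i
    · rw [X.2.2]; rfl
    · refine Fin.cases ?_ (fun j => ?_) j
      · have := h i.succ 0
        rw [X.2.2] at this
        simpa [Pi.single_apply, hw 0, eq_comm] using this
      · rfl
  right_inv Z := rfl

theorem card_diagOrth_succ [Fintype F] [DecidableEq F] (h2 : (2 : F) ≠ 0) {m : ℕ}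
    (w : Fin (m + 1) → F) (hw : ∀ i, w i ≠ 0) :
    Nat.card (diagOrth w) =
      diagFormCard w (w 0) * Nat.card (diagOrth fun i => w (Fin.succ i)) := by
  let e : diagOrth w ≃ Σ x : {x : Fin (m + 1) → F // ∑ i, w i * x i ^ 2 = w 0},
      {X // X ∈ diagOrth w ∧ X 0 = x.1} :=
    { toFun := fun X => ⟨⟨X.1 0, sum_mul_row_sq_of_mem_diagOrth X.2 0⟩, X.1, X.2, rfl⟩
      invFun := fun X => ⟨X.2.1, X.2.2.1⟩
      left_inv := fun X => rfl
      right_inv := by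
        rintro ⟨⟨x, hx⟩, X, hX, h⟩
        obtain rfl : X 0 = x := h
        rfl }
  rw [Nat.card_congr e, Nat.card_sigma, Finset.sum_congr rfl
    (g := fun _ => Nat.card (diagOrth fun i => w (Fin.succ i)))]
  · simp [diagFormCard]
  · rintro ⟨x, hx⟩ -
    obtain ⟨Y, hY, rfl⟩ := exists_mem_diagOrth_row_eq h2 hw 0 hx
    exact Nat.card_congr
      ((diagOrthRowEquiv hw hY 0).symm.trans (diagOrthStabilizerEquiv hw))

theorem card_diagOrth_odd [Fintype F] [DecidableEq F] (hF : ringChar F ≠ 2) (k : ℕ)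
    (w : Fin (2 * k + 1) → F) (hw : ∀ i, w i ≠ 0) :
    (Nat.card (diagOrth w) : ℤ) =
      2 * ∏ i ∈ Finset.Icc 1 k,
        (Fintype.card F : ℤ) ^ (2 * i - 1) * ((Fintype.card F : ℤ) ^ (2 * i) - 1) := by
  have h2 : (2 : F) ≠ 0 := Ring.two_ne_zero hF
  induction k with
  | zero =>
    rw [card_diagOrth_succ (m := 0) h2 w hw]
    have h1 := diagFormCard_odd hF 0 w hw (w 0)
    have h3 : Nat.card (diagOrth fun i : Fin 0 => w i.succ) = 1 := by
      have : diagOrth (fun i : Fin 0 => w i.succ) = Set.univ :=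
        Set.eq_univ_of_forall fun X => Subsingleton.elim _ _
      rw [this, Nat.card_univ]
      exact Nat.card_unique
    rw [h3]
    have h4 : (-1) ^ 0 * (w 0 * ∏ i, w i) = w 0 ^ 2 := by
      rw [Fin.prod_univ_succ]; simp [sq]
    rw [h4, quadraticChar_sq_one' (hw 0)] at h1
    simpa using h1
  | succ k ih =>
    have h : (Fintype.card F * (diagFormCard w (w 0) *
        diagFormCard (fun i : Fin (2 * k + 1 + 1) => w i.succ) (w (Fin.succ 0))) : ℤ) =
        Fintype.card F ^ (2 * (k + 1)) * (Fintype.card F ^ (2 * (k + 1)) - 1) :=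
      diagFormCard_mul_diagFormCard_tail hF (k + 1) w hw (hw _)
    have hc := card_diagOrth_succ (m := 2 * k + 2) h2 w hw
    have hc' := card_diagOrth_succ (m := 2 * k + 1) h2 (fun i => w i.succ) fun i => hw _
    have ih' := ih (fun i => w i.succ.succ) fun i => hw _
    rw [hc, hc', Finset.prod_Icc_succ_top (by lia)]
    push_cast
    rw [ih']
    have hq : (Fintype.card F : ℤ) ≠ 0 := by exact_mod_cast Fintype.card_ne_zero
    have hs : (Fintype.card F : ℤ) * Fintype.card F ^ (2 * (k + 1) - 1) =
        Fintype.card F ^ (2 * (k + 1)) := by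
      rw [← pow_succ']; rfl
    apply mul_left_cancel₀ hq
    set P := ∏ i ∈ Finset.Icc 1 k,
      (Fintype.card F : ℤ) ^ (2 * i - 1) * ((Fintype.card F : ℤ) ^ (2 * i) - 1)
    linear_combination 2 * P * h - 2 * P * ((Fintype.card F : ℤ) ^ (2 * (k + 1)) - 1) * hs

theorem card_special_diagOrth_odd [Fintype F] [DecidableEq F] (hF : ringChar F ≠ 2) {m : ℕ}
    (hm : Odd m) (w : Fin m → F) (hw : ∀ i, w i ≠ 0) :
    Nat.card (diagOrth w) = 2 * Nat.card {X // X ∈ diagOrth w ∧ X.det = 1} := by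
  have h2 : (2 : F) ≠ 0 := Ring.two_ne_zero hF
  have h1 : (1 : F) ≠ -1 := fun h => h2 (by linear_combination h)
  have hdet : ∀ X : Matrix (Fin m) (Fin m) F, (-X).det = -X.det := fun X => by
    rw [det_neg, Fintype.card_fin, hm.neg_one_pow, neg_one_mul]
  let e : Bool × {X // X ∈ diagOrth w ∧ X.det = 1} → diagOrth w := fun p =>
    if p.1 then ⟨p.2.1, p.2.2.1⟩ else ⟨-p.2.1, diagOrth_neg p.2.2.1⟩
  have he : Function.Bijective e := by
    constructor
    · rintro ⟨a, X, hX, hX1⟩ ⟨b, Y, hY, hY1⟩ h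
      have h := congrArg Subtype.val h
      cases a <;> cases b <;> simp [e] at h
      · simp [h]
      · rw [← h, hdet, hX1] at hY1
        exact absurd hY1.symm h1
      · rw [h, hdet, hY1] at hX1
        exact absurd hX1.symm h1
      · simp [h]
    · rintro ⟨X, hX⟩
      rcases sq_eq_one_iff.1 (det_sq_of_mem_diagOrth hw hX) with h | h
      · exact ⟨(true, ⟨X, hX, h⟩), rfl⟩
      · exact ⟨(false, ⟨-X, diagOrth_neg hX, by rw [hdet, h, neg_neg]⟩), by simp [e]⟩
  rw [← Nat.card_eq_of_bijective e he, Nat.card_prod]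
  simp

end OrthogonalGroup

section DualNumber

open DualNumber

theorem dualMatrix_ext {F ι : Type*} {A B : Matrix ι ι F[ε]}
    (h1 : A.map TrivSqZeroExt.fst = B.map TrivSqZeroExt.fst)
    (h2 : A.map TrivSqZeroExt.snd = B.map TrivSqZeroExt.snd) : A = B := by
  ext i j
  · exact congrFun (congrFun h1 i) j
  · exact congrFun (congrFun h2 i) j

variable {F : Type*} [Field F]

theorem map_fst_mul {ι : Type*} [Fintype ι] (A B : Matrix ι ι F[ε]) : (A * B).map TrivSqZeroExt.fst =
    A.map TrivSqZeroExt.fst * B.map TrivSqZeroExt.fst := by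
  ext i j
  simp [Matrix.mul_apply, TrivSqZeroExt.fst_sum]

theorem map_snd_mul {ι : Type*} [Fintype ι] (A B : Matrix ι ι F[ε]) : (A * B).map TrivSqZeroExt.snd =
    A.map TrivSqZeroExt.fst * B.map TrivSqZeroExt.snd +
      A.map TrivSqZeroExt.snd * B.map TrivSqZeroExt.fst := by
  ext i j
  simp [Matrix.mul_apply, TrivSqZeroExt.snd_sum, Finset.sum_add_distrib, mul_comm]

/-- Conjugation `a + b ε ↦ a - b ε` on the dual numbers. -/
def dualConj (F : Type*) [Field F] : F[ε] →+* F[ε] :=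
  (TrivSqZeroExt.map (-LinearMap.id : F →ₗ[F] F)).toRingHom

theorem fst_dualConj (x : F[ε]) : (dualConj F x).fst = x.fst :=
  TrivSqZeroExt.fst_map _ x

theorem snd_dualConj (x : F[ε]) : (dualConj F x).snd = -x.snd :=
  TrivSqZeroExt.snd_map _ x

variable {ι : Type*} [Fintype ι] [DecidableEq ι]

theorem card_isSymm_sum_diag_eq_zero_mul [Finite F] [Nonempty ι] {w : ι → F}
    (hw : ∀ i, w i ≠ 0) :
    Nat.card {S : Matrix ι ι F // S.IsSymm ∧ ∑ i, S i i * w i = 0} * Nat.card F =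
      Nat.card F ^ (Fintype.card ι + 1).choose 2 := by
  let f : (Sym2 ι → F) →+ F :=
    { toFun := fun g => ∑ i, g s(i, i) * w i
      map_zero' := by simp
      map_add' := fun g h => by simp [add_mul, Finset.sum_add_distrib] }
  have hf : Function.Surjective f := by
    intro t
    obtain ⟨i₀⟩ := ‹Nonempty ι›
    refine ⟨fun z => if z = s(i₀, i₀) then t / w i₀ else 0, ?_⟩
    simp [f, hw i₀]
  let e : {S : Matrix ι ι F // S.IsSymm ∧ ∑ i, S i i * w i = 0} ≃ f.ker :=
    { toFun := fun S => ⟨Sym2.lift ⟨fun i j => S.1 i j, fun i j => S.2.1.apply j i⟩, S.2.2⟩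
      invFun := fun g => ⟨of fun i j => g.1 s(i, j),
        IsSymm.ext fun i j => congrArg g.1 Sym2.eq_swap, g.2⟩
      left_inv := fun S => rfl
      right_inv := fun g => Subtype.ext (funext <| Sym2.ind fun i j => rfl) }
  have h := f.ker.card_mul_index
  rw [AddSubgroup.index_ker, AddMonoidHom.range_eq_top.2 hf, AddSubgroup.card_top] at h
  rw [Nat.card_congr e, h, Nat.card_fun, Nat.card_eq_fintype_card (α := Sym2 ι), Sym2.card]

/-- The matrix `(1 + ε Z) X` over the dual numbers. -/
def dualMatrix (X Z : Matrix ι ι F) : Matrix ι ι F[ε] :=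
  (1 + (ε : F[ε]) • Z.map TrivSqZeroExt.inl) * X.map TrivSqZeroExt.inl

theorem map_fst_dualMatrix (X Z : Matrix ι ι F) :
    (dualMatrix X Z).map TrivSqZeroExt.fst = X := by
  have h : (1 + (ε : F[ε]) • (Z.map TrivSqZeroExt.inl : Matrix ι ι F[ε])).map TrivSqZeroExt.fst = 1 := by
    ext i j
    simp [Matrix.one_apply, apply_ite TrivSqZeroExt.fst]
  rw [dualMatrix, map_fst_mul, h, one_mul]
  ext i j
  simp

theorem map_snd_dualMatrix (X Z : Matrix ι ι F) :
    (dualMatrix X Z).map TrivSqZeroExt.snd = Z * X := by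
  have h : (1 + (ε : F[ε]) • (Z.map TrivSqZeroExt.inl : Matrix ι ι F[ε])).map TrivSqZeroExt.snd = Z := by
    ext i j
    simp [Matrix.one_apply, apply_ite TrivSqZeroExt.snd]
  have h1 : (X.map TrivSqZeroExt.inl : Matrix ι ι F[ε]).map TrivSqZeroExt.snd = 0 := by
    ext i j
    simp
  have h2 : (X.map TrivSqZeroExt.inl : Matrix ι ι F[ε]).map TrivSqZeroExt.fst = X := by
    ext i j
    simp
  rw [dualMatrix, map_snd_mul, h, h1, h2, mul_zero, zero_add]

theorem det_dualMatrix (X Z : Matrix ι ι F) :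
    (dualMatrix X Z).det =
      TrivSqZeroExt.inl X.det + (ε : F[ε]) * TrivSqZeroExt.inl (Z.trace * X.det) := by
  have h : ∀ Y : Matrix ι ι F, (Y.map TrivSqZeroExt.inl : Matrix ι ι F[ε]).det =
      TrivSqZeroExt.inl Y.det := fun Y =>
    (RingHom.map_det (TrivSqZeroExt.inlHom F F) Y).symm
  have ht : (Z.map TrivSqZeroExt.inl : Matrix ι ι F[ε]).trace = TrivSqZeroExt.inl Z.trace :=
    (AddMonoidHom.map_trace (TrivSqZeroExt.inlHom F F).toAddMonoidHom Z).symm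
  rw [dualMatrix, det_mul, det_one_add_smul, h, ht, sq, DualNumber.eps_mul_eps]
  simp only [TrivSqZeroExt.inl_mul]
  ring

theorem dual_unitary_iff {w : ι → F} {A : Matrix ι ι F[ε]} :
    A * diagonal (fun i => TrivSqZeroExt.inl (w i)) * (A.map (dualConj F))ᵀ =
        diagonal (fun i => TrivSqZeroExt.inl (w i)) ↔
      A.map TrivSqZeroExt.fst ∈ diagOrth w ∧
        (A.map TrivSqZeroExt.snd * diagonal w * (A.map TrivSqZeroExt.fst)ᵀ).IsSymm := by
  have h1 : (diagonal fun i => (TrivSqZeroExt.inl (w i) : F[ε])).map TrivSqZeroExt.fst =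
      diagonal w := by
    rw [diagonal_map (TrivSqZeroExt.fst_zero)]; rfl
  have h2 : (diagonal fun i => (TrivSqZeroExt.inl (w i) : F[ε])).map TrivSqZeroExt.snd = 0 := by
    rw [diagonal_map (TrivSqZeroExt.snd_zero)]
    ext i j
    simp [diagonal_apply]
  have h3 : (A.map (dualConj F))ᵀ.map TrivSqZeroExt.fst = (A.map TrivSqZeroExt.fst)ᵀ := by
    ext i j
    exact fst_dualConj _
  have h4 : (A.map (dualConj F))ᵀ.map TrivSqZeroExt.snd = -(A.map TrivSqZeroExt.snd)ᵀ := by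
    ext i j
    exact snd_dualConj _
  have key : ∀ X Y : Matrix ι ι F,
      X * diagonal w * -Yᵀ + Y * diagonal w * Xᵀ = 0 ↔ (Y * diagonal w * Xᵀ).IsSymm := by
    intro X Y
    rw [IsSymm, transpose_mul, transpose_mul, transpose_transpose, diagonal_transpose,
      ← Matrix.mul_assoc, mul_neg, neg_add_eq_zero]
  rw [← key]
  constructor
  · intro h
    have hf := congrArg (fun M => M.map TrivSqZeroExt.fst) h
    have hs := congrArg (fun M => M.map TrivSqZeroExt.snd) h
    simp only [map_fst_mul, map_snd_mul, h1, h2, h3, h4, mul_zero, zero_add] at hf hs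
    exact ⟨hf, hs⟩
  · rintro ⟨hf, hs⟩
    refine dualMatrix_ext ?_ ?_
    · rw [map_fst_mul, map_fst_mul, h1, h3]
      exact hf
    · rw [map_snd_mul, map_snd_mul, map_fst_mul, h1, h2, h3, h4, mul_zero, zero_add]
      exact hs

theorem card_dual_special_unitary {w : ι → F} (hw : ∀ i, w i ≠ 0) :
    Nat.card {A : Matrix ι ι F[ε] //
        A * diagonal (fun i => TrivSqZeroExt.inl (w i)) * (A.map (dualConj F))ᵀ =
          diagonal (fun i => TrivSqZeroExt.inl (w i)) ∧ A.det = 1} =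
      Nat.card {X // X ∈ diagOrth w ∧ X.det = 1} *
        Nat.card {S : Matrix ι ι F // S.IsSymm ∧ ∑ i, S i i * (w i)⁻¹ = 0} := by
  set D' : Matrix ι ι F := diagonal fun i => (w i)⁻¹ with hD'
  have hDD : diagonal w * D' = 1 := by
    rw [hD', diagonal_mul_diagonal, ← diagonal_one]
    congr 1
    ext i
    exact mul_inv_cancel₀ (hw i)
  have hDD' : D' * diagonal w = 1 := mul_eq_one_comm.1 hDD
  have hX : ∀ X ∈ diagOrth w, D' * X * (diagonal w * Xᵀ) = 1 := by
    intro X hX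
    rw [Matrix.mul_assoc, ← Matrix.mul_assoc X, show X * diagonal w * Xᵀ = diagonal w from hX,
      hDD']
  have htr : ∀ S : Matrix ι ι F, (S * D').trace = ∑ i, S i i * (w i)⁻¹ := by
    intro S
    simp [trace, hD']
  rw [← Nat.card_prod]
  symm
  refine Nat.card_eq_of_bijective (fun P => ⟨dualMatrix P.1.1 (P.2.1 * D'), ?_, ?_⟩) ⟨?_, ?_⟩
  · rw [dual_unitary_iff, map_fst_dualMatrix, map_snd_dualMatrix]
    refine ⟨P.1.2.1, ?_⟩
    rw [Matrix.mul_assoc, Matrix.mul_assoc, Matrix.mul_assoc, ← Matrix.mul_assoc D',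
      hX _ P.1.2.1, mul_one]
    exact P.2.2.1
  · rw [det_dualMatrix, htr, P.2.2.2, P.1.2.2]
    simp
  · rintro ⟨⟨X, hX1, hX2⟩, S, hS1, hS2⟩ ⟨⟨X', hX1', hX2'⟩, S', hS1', hS2'⟩ h
    have h := congrArg Subtype.val h
    have hf := congrArg (fun M => M.map TrivSqZeroExt.fst) h
    have hs := congrArg (fun M => M.map TrivSqZeroExt.snd) h
    simp only [map_fst_dualMatrix, map_snd_dualMatrix] at hf hs
    subst hf
    have key : ∀ T : Matrix ι ι F, T * D' * X * (diagonal w * Xᵀ) = T := fun T => by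
      rw [Matrix.mul_assoc T, Matrix.mul_assoc T, hX X hX1, mul_one]
    have hSS : S = S' := by rw [← key S, hs, key]
    subst hSS
    rfl
  · rintro ⟨A, hA, hdet⟩
    obtain ⟨h1, h2⟩ := dual_unitary_iff.1 hA
    set X := A.map TrivSqZeroExt.fst with hXdef
    set Y := A.map TrivSqZeroExt.snd with hYdef
    have hA' : dualMatrix X (Y * diagonal w * Xᵀ * D') = A := by
      refine dualMatrix_ext (map_fst_dualMatrix _ _) ?_
      rw [map_snd_dualMatrix, Matrix.mul_assoc, Matrix.mul_assoc Y, Matrix.mul_assoc Y,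
        mul_eq_one_comm.1 (hX X h1), mul_one]
    have hd := hdet
    rw [← hA', det_dualMatrix] at hd
    have hd1 : X.det = 1 := by simpa using congrArg TrivSqZeroExt.fst hd
    have hd2 : (Y * diagonal w * Xᵀ * D').trace = 0 := by
      simpa [hd1] using congrArg TrivSqZeroExt.snd hd
    exact ⟨⟨⟨X, h1, hd1⟩, ⟨_, h2, by rw [← htr, hd2]⟩⟩, Subtype.ext hA'⟩

end DualNumber

section Quotient

open DualNumber

variable {d : ℤ} {p : ℕ} [Fact p.Prime]

/-- Reduction `ℤ[√-d] → 𝔽_p[ε]`, `√-d ↦ ε`, for `p ∣ d`. -/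
noncomputable def zsqrtdToDual (hpd : (p : ℤ) ∣ d) : Zsqrtd (-d) →+* (ZMod p)[ε] :=
  Zsqrtd.lift ⟨ε, by
    have h : ((d : ℤ) : ZMod p) = 0 := (ZMod.intCast_zmod_eq_zero_iff_dvd d p).2 hpd
    rw [DualNumber.eps_mul_eps]
    ext <;> simp [h]⟩

theorem fst_zsqrtdToDual (hpd : (p : ℤ) ∣ d) (x : Zsqrtd (-d)) :
    (zsqrtdToDual hpd x).fst = x.re := by
  simp [zsqrtdToDual, Zsqrtd.lift]

theorem snd_zsqrtdToDual (hpd : (p : ℤ) ∣ d) (x : Zsqrtd (-d)) :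
    (zsqrtdToDual hpd x).snd = x.im := by
  simp [zsqrtdToDual, Zsqrtd.lift]

theorem zsqrtdToDual_surjective (hpd : (p : ℤ) ∣ d) :
    Function.Surjective (zsqrtdToDual hpd) := by
  intro y
  obtain ⟨a, ha⟩ := ZMod.intCast_surjective y.fst
  obtain ⟨b, hb⟩ := ZMod.intCast_surjective y.snd
  refine ⟨⟨a, b⟩, TrivSqZeroExt.ext ?_ ?_⟩
  · rw [fst_zsqrtdToDual, ha]
  · rw [snd_zsqrtdToDual, hb]

theorem ker_zsqrtdToDual (hpd : (p : ℤ) ∣ d) :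
    RingHom.ker (zsqrtdToDual hpd) = Ideal.span {((p : ℤ) : Zsqrtd (-d))} := by
  ext x
  rw [RingHom.mem_ker, Ideal.mem_span_singleton, Zsqrtd.intCast_dvd, TrivSqZeroExt.ext_iff,
    fst_zsqrtdToDual, snd_zsqrtdToDual, TrivSqZeroExt.fst_zero, TrivSqZeroExt.snd_zero,
    ZMod.intCast_zmod_eq_zero_iff_dvd, ZMod.intCast_zmod_eq_zero_iff_dvd]

/-- For `p ∣ d` the ring `ℤ[√-d]/(p)` is the ring of dual numbers over `𝔽_p`. -/
noncomputable def rqEquivDual (hpd : (p : ℤ) ∣ d) : Rq d p ≃+* (ZMod p)[ε] :=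
  (Ideal.quotEquivOfEq (ker_zsqrtdToDual hpd).symm).trans
    (RingHom.quotientKerEquivOfSurjective (zsqrtdToDual_surjective hpd))

theorem rqEquivDual_mk (hpd : (p : ℤ) ∣ d) (x : Zsqrtd (-d)) :
    rqEquivDual hpd (Ideal.Quotient.mk _ x) = zsqrtdToDual hpd x :=
  rfl

theorem rqEquivDual_conjQ (hpd : (p : ℤ) ∣ d) (x : Rq d p) :
    rqEquivDual hpd (conjQ d p x) = dualConj (ZMod p) (rqEquivDual hpd x) := by
  obtain ⟨x, rfl⟩ := Ideal.Quotient.mk_surjective x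
  rw [conjQ, Ideal.quotientMap_mk, rqEquivDual_mk, rqEquivDual_mk]
  ext
  · rw [fst_dualConj, fst_zsqrtdToDual, fst_zsqrtdToDual, starRingEnd_apply, Zsqrtd.re_star]
  · rw [snd_dualConj, snd_zsqrtdToDual, snd_zsqrtdToDual, starRingEnd_apply, Zsqrtd.im_star,
      Int.cast_neg]

end Quotient

theorem card_special_unitary_congr {R R' : Type*} [CommRing R] [CommRing R'] (φ : R ≃+* R')
    {σ : R →+* R} {σ' : R' →+* R'} (h : ∀ x, φ (σ x) = σ' (φ x)) {ι : Type*} [Fintype ι]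
    [DecidableEq ι] (L : Matrix ι ι R) :
    Nat.card {A : Matrix ι ι R // A * L * (A.map σ)ᵀ = L ∧ A.det = 1} =
      Nat.card {A : Matrix ι ι R' // A * L.map φ * (A.map σ')ᵀ = L.map φ ∧ A.det = 1} := by
  refine Nat.card_congr (φ.mapMatrix.toEquiv.subtypeEquiv fun A => ?_)
  have hA : (φ.mapMatrix A).map σ' = φ.mapMatrix (A.map σ) := by
    ext i j
    simp [h]
  have hT : (φ.mapMatrix (A.map σ))ᵀ = φ.mapMatrix (A.map σ)ᵀ := rfl
  have hd : (φ.mapMatrix A).det = φ A.det := (RingEquiv.map_det φ A).symm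
  have hL : L.map φ = φ.mapMatrix L := rfl
  change _ ↔ φ.mapMatrix A * L.map φ * ((φ.mapMatrix A).map σ')ᵀ = _ ∧ (φ.mapMatrix A).det = 1
  rw [hA, hT, hd, hL, ← map_mul, ← map_mul, EquivLike.apply_eq_iff_eq, map_eq_one_iff _ φ.injective]

/-- For `n` even and an odd ramified prime `p ∣ d`, the order of `SU(L, ℤ[√-d]/(p))`
equals `p^{(n+1)²-1} · ∏_{i=1}^{n/2} (1 - p^{-2i})`. -/
theorem card_SU_L_mod_p_ramified_even (d : ℤ) (hd : 0 < d) (hodd : Odd d)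
    (hsf : Squarefree d) (n : ℕ) (hn : 2 ≤ n) (hneven : Even n)
    (p : ℕ) (hp : p.Prime) (hp2 : p ≠ 2) (hpd : (p : ℤ) ∣ d) :
    (Nat.card {A : Matrix (Fin (n + 1)) (Fin (n + 1)) (Rq d p) //
        A * Lmat (Rq d p) n * (A.map (conjQ d p))ᵀ = Lmat (Rq d p) n ∧
        A.det = 1} : ℚ)
      = (p : ℚ) ^ ((n + 1) ^ 2 - 1) *
        ∏ i ∈ Finset.Icc 1 (n / 2), (1 - (p : ℚ) ^ (-(2 * (i : ℤ)))) := by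
  have : Fact p.Prime := ⟨hp⟩
  obtain ⟨k, hk⟩ := hneven
  obtain rfl : n = 2 * k := by lia
  let w : Fin (2 * k + 1) → ZMod p := fun i => if i = Fin.last (2 * k) then -1 else 1
  have hw : ∀ i, w i ≠ 0 := by
    intro i
    by_cases h : i = Fin.last (2 * k) <;> simp [w, h]
  have hL : (Lmat (Rq d p) (2 * k)).map (rqEquivDual hpd) =
      diagonal fun i => TrivSqZeroExt.inl (w i) := by
    rw [Lmat, diagonal_map (map_zero _)]
    congr 1
    ext i : 1
    by_cases h : i = Fin.last (2 * k) <;> simp [w, h]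
  have hF : ringChar (ZMod p) ≠ 2 := by rwa [ZMod.ringChar_zmod_n]
  have hO := card_diagOrth_odd hF k w hw
  have hSO := card_special_diagOrth_odd hF (odd_two_mul_add_one k) w hw
  have hS := card_isSymm_sum_diag_eq_zero_mul fun i => inv_ne_zero (hw i)
  rw [card_special_unitary_congr _ (rqEquivDual_conjQ hpd), hL, card_dual_special_unitary hw]
  rw [hSO, ZMod.card] at hO
  rw [Nat.card_zmod, Fintype.card_fin] at hS
  set a := Nat.card {X // X ∈ diagOrth w ∧ X.det = 1}
  set b := Nat.card {S : Matrix (Fin (2 * k + 1)) (Fin (2 * k + 1)) (ZMod p) //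
    S.IsSymm ∧ ∑ i, S i i * (w i)⁻¹ = 0}
  have hp0 : (p : ℚ) ≠ 0 := by exact_mod_cast hp.ne_zero
  have hprod : ∀ k : ℕ, ∏ i ∈ Finset.Icc 1 k, ((p : ℚ) ^ (2 * i - 1) * ((p : ℚ) ^ (2 * i) - 1)) =
      (p : ℚ) ^ (2 * k ^ 2 + k) *
        ∏ i ∈ Finset.Icc 1 k, (1 - (p : ℚ) ^ (-(2 * (i : ℤ)))) := by
    intro k
    induction k with
    | zero => simp
    | succ k ih =>
      rw [Finset.prod_Icc_succ_top (by lia), Finset.prod_Icc_succ_top (by lia), ih]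
      have h1 : (p : ℚ) ^ (-(2 * ((k + 1 : ℕ) : ℤ))) = ((p : ℚ) ^ (2 * (k + 1)))⁻¹ := by
        rw [_root_.zpow_neg]
        norm_cast
      rw [h1, show 2 * (k + 1) - 1 = 2 * k + 1 by lia]
      field_simp
      ring
  have hO' : (a : ℚ) = ∏ i ∈ Finset.Icc 1 k, ((p : ℚ) ^ (2 * i - 1) * ((p : ℚ) ^ (2 * i) - 1)) := by
    have h : (a : ℤ) = ∏ i ∈ Finset.Icc 1 k, ((p : ℤ) ^ (2 * i - 1) * ((p : ℤ) ^ (2 * i) - 1)) := by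
      push_cast at hO
      linarith
    exact_mod_cast congrArg (Int.cast : ℤ → ℚ) h
  have hch : (2 * k + 1 + 1).choose 2 = 2 * k ^ 2 + 3 * k + 1 := by
    rw [Nat.choose_two_right, show (2 * k + 1 + 1) * (2 * k + 1 + 1 - 1) =
      2 * (2 * k ^ 2 + 3 * k + 1) by rw [Nat.add_sub_cancel]; ring, Nat.mul_div_cancel_left _ two_pos]
  have hb : (b : ℚ) = (p : ℚ) ^ (2 * k ^ 2 + 3 * k) := by
    rw [hch, pow_succ] at hS
    exact_mod_cast Nat.eq_of_mul_eq_mul_right hp.pos hS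
  rw [Nat.mul_div_cancel_left _ two_pos, Nat.cast_mul, hO', hprod, hb,
    show (2 * k + 1) ^ 2 - 1 = (2 * k ^ 2 + k) + (2 * k ^ 2 + 3 * k) by
      rw [show (2 * k + 1) ^ 2 = (2 * k ^ 2 + k) + (2 * k ^ 2 + 3 * k) + 1 by ring]
      rfl, pow_add]
  ring
end
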